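/- Fix k ∈ ℕ and ε > 0. Then C_loc^{k,ε}(ℝ) ⊆ NC^k(ℝ): every f ∈ C^k(ℝ) whose k-th derivative is ε-Hölder continuous on each interval [-r,r] belongs to 𝒞^{[k]}(ℝ), and there is a sequence of polynomials (q_n) with ‖f − q_n‖_{𝒞^{[k]},r} → 0 for every r > 0. -/

import Mathlib

open MeasureTheory Filter
open scoped ENNReal NNReal

/-- The continuous extension of the `k`-th divided difference of a `C^k` function, given by
integration of the `k`-th derivative over the standard simplex (Proposition 2.3(ii)). -/
noncomputable def divDiffC (f : ℝ → ℂ) (k : ℕ) (lam : Fin (k + 1) → ℝ) : ℂ :=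
  ∫ s in {s : Fin k → ℝ | (∀ i, 0 ≤ s i) ∧ ∑ i, s i ≤ 1},
    iteratedDeriv k f
      ((∑ i : Fin k, s i * lam i.castSucc) + (1 - ∑ i : Fin k, s i) * lam (Fin.last k))

/-- The `ℓ^∞`-integral projective tensor norm of a function `φ : Ω_1 × ⋯ × Ω_m → ℂ`:
the infimum, over all `ℓ^∞`-integral projective decompositions
`(Σ, ρ, φ_1, …, φ_m)` of `φ` (with `ρ` a σ-finite measure, the `φ_j` product-measurable and
bounded in the first variable, and `φ(ω) = ∫_Σ ∏_j φ_j(ω_j, σ) ρ(dσ)`), of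
`∫_Σ ∏_j sup_{ω_j} |φ_j(ω_j, σ)| ρ(dσ)`; it is `∞` if no decomposition exists. -/
noncomputable def iptNorm {m : ℕ} {Ω : Fin m → Type*} [∀ i, MeasurableSpace (Ω i)]
    (φ : (∀ i, Ω i) → ℂ) : ℝ≥0∞ :=
  sInf {c : ℝ≥0∞ |
    ∃ (S : Type) (_ : MeasurableSpace S) (ρ : MeasureTheory.Measure S)
      (φs : ∀ i, Ω i × S → ℂ),
      MeasureTheory.SigmaFinite ρ ∧ (∀ i, Measurable (φs i)) ∧
      (∀ i σ, ∃ C : ℝ, ∀ ω, ‖φs i (ω, σ)‖ ≤ C) ∧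
      (∫⁻ σ, ∏ i, ⨆ ω, (‖φs i (ω, σ)‖₊ : ℝ≥0∞) ∂ρ) ≠ ∞ ∧
      (∀ ω : ∀ i, Ω i, φ ω = ∫ σ, ∏ i, φs i (ω i, σ) ∂ρ) ∧
      c = ∫⁻ σ, ∏ i, ⨆ ω, (‖φs i (ω, σ)‖₊ : ℝ≥0∞) ∂ρ}

/-- `‖φ‖_{r,m}` : the `ℓ^∞`-integral projective tensor norm of `φ` restricted to `[-r,r]^m`. -/
noncomputable def iptNormIcc (r : ℝ) {m : ℕ} (φ : (Fin m → ℝ) → ℂ) : ℝ≥0∞ :=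
  iptNorm (Ω := fun _ : Fin m => (Set.Icc (-r) r : Set ℝ)) fun ω => φ fun i => (ω i : ℝ)

/-- `‖f‖_{𝒞^{[k]},r} = ∑_{j=0}^k ‖f^{[j]}‖_{r,j+1}`. -/
noncomputable def cNorm (k : ℕ) (r : ℝ) (f : ℝ → ℂ) : ℝ≥0∞ :=
  ∑ j ∈ Finset.range (k + 1), iptNormIcc r (divDiffC f j)

/-- `φ` has a decomposition on `[-r,r]^m` of finite cost at most `c`. -/
def HasDec (r : ℝ) {m : ℕ} (φ : (Fin m → ℝ) → ℂ) (c : ℝ≥0∞) : Prop :=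
  ∃ (S : Type) (_ : MeasurableSpace S) (ρ : MeasureTheory.Measure S)
      (φs : ∀ _ : Fin m, (Set.Icc (-r) r : Set ℝ) × S → ℂ),
      MeasureTheory.SigmaFinite ρ ∧ (∀ i, Measurable (φs i)) ∧
      (∀ i σ, ∃ C : ℝ, ∀ ω, ‖φs i (ω, σ)‖ ≤ C) ∧
      (∫⁻ σ, ∏ i, ⨆ ω, (‖φs i (ω, σ)‖₊ : ℝ≥0∞) ∂ρ) ≠ ∞ ∧
      (∀ ω : Fin m → (Set.Icc (-r) r : Set ℝ), φ (fun i => (ω i : ℝ)) = ∫ σ, ∏ i, φs i (ω i, σ) ∂ρ) ∧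
      ∫⁻ σ, ∏ i, ⨆ ω, (‖φs i (ω, σ)‖₊ : ℝ≥0∞) ∂ρ ≤ c

lemma HasDec.le {r : ℝ} {m : ℕ} {φ : (Fin m → ℝ) → ℂ} {c : ℝ≥0∞} (h : HasDec r φ c) :
    iptNormIcc r φ ≤ c := by
  obtain ⟨S, mS, ρ, φs, h1, h2, h3, h4, h5, h6⟩ := h
  exact le_trans (sInf_le ⟨S, mS, ρ, φs, h1, h2, h3, h4, h5, rfl⟩) h6

lemma HasDec.mono {r : ℝ} {m : ℕ} {φ : (Fin m → ℝ) → ℂ} {c d : ℝ≥0∞} (h : HasDec r φ c)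
    (hcd : c ≤ d) : HasDec r φ d := by
  obtain ⟨S, mS, ρ, φs, h1, h2, h3, h4, h5, h6⟩ := h
  exact ⟨S, mS, ρ, φs, h1, h2, h3, h4, h5, h6.trans hcd⟩

lemma HasDec.congr {r : ℝ} {m : ℕ} {φ ψ : (Fin m → ℝ) → ℂ} {c : ℝ≥0∞} (h : HasDec r φ c)
    (hh : ∀ l : Fin m → ℝ, (∀ i, l i ∈ Set.Icc (-r) r) → φ l = ψ l) : HasDec r ψ c := by
  obtain ⟨S, mS, ρ, φs, h1, h2, h3, h4, h5, h6⟩ := h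
  refine ⟨S, mS, ρ, φs, h1, h2, h3, h4, fun ω => ?_, h6⟩
  rw [← h5, hh]
  exact fun i => (ω i).2

lemma dec_integrable {r : ℝ} {m : ℕ} {S : Type} [MeasurableSpace S] {ρ : Measure S}
    {φs : ∀ _ : Fin m, (Set.Icc (-r) r : Set ℝ) × S → ℂ} (h2 : ∀ i, Measurable (φs i))
    (h4 : (∫⁻ σ, ∏ i, ⨆ ω, (‖φs i (ω, σ)‖₊ : ℝ≥0∞) ∂ρ) ≠ ∞)
    (ω : Fin m → (Set.Icc (-r) r : Set ℝ)) : Integrable (fun σ => ∏ i, φs i (ω i, σ)) ρ := by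
  refine ⟨?_, ?_⟩
  · apply Measurable.aestronglyMeasurable
    apply Finset.measurable_fun_prod
    intro i _
    exact (h2 i).comp (by fun_prop)
  · refine lt_of_le_of_lt (lintegral_mono fun σ => ?_) (lt_top_iff_ne_top.2 h4)
    rw [enorm_eq_nnnorm, nnnorm_prod]
    push_cast
    apply Finset.prod_le_prod'
    intro i _
    exact le_iSup (fun w => (‖φs i (w, σ)‖₊ : ℝ≥0∞)) (ω i)

lemma HasDec.add {r : ℝ} {m : ℕ} {φ ψ : (Fin m → ℝ) → ℂ} {c d : ℝ≥0∞} (h : HasDec r φ c)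
    (h' : HasDec r ψ d) : HasDec r (fun l => φ l + ψ l) (c + d) := by
  obtain ⟨S, mS, ρ, φs, h1, h2, h3, h4, h5, h6⟩ := h
  obtain ⟨S', mS', ρ', φs', h1', h2', h3', h4', h5', h6'⟩ := h'
  have e1 : MeasurableEmbedding (Sum.inl : S → S ⊕ S') := ⟨Sum.inl_injective, measurable_inl, fun _ hs => measurableSet_inl_image.2 hs⟩
  have e2 : MeasurableEmbedding (Sum.inr : S' → S ⊕ S') := ⟨Sum.inr_injective, measurable_inr, fun _ hs => measurableSet_inr_image.2 hs⟩
  let F : Fin m → (Set.Icc (-r) r : Set ℝ) × (S ⊕ S') → ℂ := fun i p =>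
    Sum.elim (fun s => φs i (p.1, s)) (fun s => φs' i (p.1, s)) p.2
  have key : (∫⁻ σ, ∏ i, ⨆ ω, (‖F i (ω, σ)‖₊ : ℝ≥0∞) ∂(ρ.map Sum.inl + ρ'.map Sum.inr)) =
      (∫⁻ σ, ∏ i, ⨆ ω, (‖φs i (ω, σ)‖₊ : ℝ≥0∞) ∂ρ) +
      (∫⁻ σ, ∏ i, ⨆ ω, (‖φs' i (ω, σ)‖₊ : ℝ≥0∞) ∂ρ') := by
    rw [lintegral_add_measure, e1.lintegral_map, e2.lintegral_map]
    rfl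
  have hF : ∀ i, Measurable (F i) := by
    intro i
    have : F i = (Sum.elim (φs i) (φs' i)) ∘
      (MeasurableEquiv.prodSumDistrib (Set.Icc (-r) r : Set ℝ) S S') := by
      ext ⟨x, s⟩
      rcases s with s | s <;> rfl
    rw [this]
    exact ((h2 i).sumElim (h2' i)).comp (MeasurableEquiv.measurable _)
  have hfin : (∫⁻ σ, ∏ i, ⨆ ω, (‖F i (ω, σ)‖₊ : ℝ≥0∞) ∂(ρ.map Sum.inl + ρ'.map Sum.inr)) ≠ ∞ := by
    rw [key]; exact ENNReal.add_ne_top.2 ⟨h4, h4'⟩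
  have hsf1 := e1.sigmaFinite_map (μ := ρ)
  have hsf2 := e2.sigmaFinite_map (μ := ρ')
  refine ⟨S ⊕ S', inferInstance, ρ.map Sum.inl + ρ'.map Sum.inr, F, inferInstance, hF, ?_, hfin, ?_, ?_⟩
  · rintro i (s | s)
    · exact h3 i s
    · exact h3' i s
  · intro ω
    have I := dec_integrable hF hfin ω
    rw [integrable_add_measure] at I
    beta_reduce
    rw [integral_add_measure I.1 I.2, e1.integral_map, e2.integral_map, h5, h5']
    rfl
  · rw [key]; exact add_le_add h6 h6'

lemma hasDec_const (r : ℝ) (k : ℕ) (c : ℂ) :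
    HasDec r (fun _ : Fin (k + 1) → ℝ => c) ‖c‖₊ := by
  have b : (∫⁻ σ : Unit, ∏ i : Fin (k + 1), ⨆ ω : (Set.Icc (-r) r : Set ℝ),
      (‖(if i = Fin.last k then c else 1 : ℂ)‖₊ : ℝ≥0∞) ∂(Measure.dirac ())) ≤ ‖c‖₊ := by
    rw [lintegral_dirac, Fin.prod_univ_castSucc]
    have : ∏ i : Fin k, ⨆ ω : (Set.Icc (-r) r : Set ℝ),
      (‖(if i.castSucc = Fin.last k then c else 1 : ℂ)‖₊ : ℝ≥0∞) ≤ 1 := by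
      apply Finset.prod_le_one'
      intro i _
      simp [Fin.castSucc_ne_last]
    calc _ ≤ 1 * (⨆ ω : (Set.Icc (-r) r : Set ℝ),
      (‖(if Fin.last k = Fin.last k then c else 1 : ℂ)‖₊ : ℝ≥0∞)) := mul_le_mul_left this _
      _ ≤ _ := by
        rw [one_mul]
        simp
  refine ⟨Unit, inferInstance, Measure.dirac (), fun i _ => if i = Fin.last k then c else 1,
    inferInstance, fun i => measurable_const, fun i _ => ⟨_, fun _ => le_rfl⟩, ?_, ?_, b⟩
  · exact ne_top_of_le_ne_top ENNReal.coe_ne_top b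
  · intro ω
    rw [integral_dirac, Fin.prod_univ_castSucc]
    simp [Fin.castSucc_ne_last]

/-- Abel summation bound. -/
lemma abel_bound (a : ℕ → ℂ) (w : ℕ → ℝ) (hw : ∀ v, 0 ≤ w v) (M : ℕ)
    (hanti : ∀ v, M ≤ v → w (v + 1) ≤ w v)
    (B : ℝ) (hB : ∀ N, M ≤ N → ‖∑ v ∈ Finset.Ico M N, a v‖ ≤ B) (N : ℕ) (hN : M ≤ N) :
    ‖∑ v ∈ Finset.Ico M N, a v * w v‖ ≤ B * w M := by
  have key : ‖∑ v ∈ Finset.Ico M N, a v * w v - w N * ∑ v ∈ Finset.Ico M N, a v‖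
      ≤ B * (w M - w N) := by
    induction N, hN using Nat.le_induction with
    | base => simp
    | succ n hn ih =>
      have e : ∑ v ∈ Finset.Ico M (n+1), a v * w v - w (n+1) * ∑ v ∈ Finset.Ico M (n+1), a v
        = (∑ v ∈ Finset.Ico M n, a v * w v - w n * ∑ v ∈ Finset.Ico M n, a v) +
          (w n - w (n+1) : ℝ) * ∑ v ∈ Finset.Ico M (n+1), a v := by
        rw [Finset.sum_Ico_succ_top hn, Finset.sum_Ico_succ_top hn]
        push_cast
        ring
      rw [e]
      have h1 := hB (n+1) (by omega)
      have h2 := hanti n hn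
      calc _ ≤ _ := norm_add_le _ _
        _ ≤ B * (w M - w n) + (w n - w (n+1)) * B := by
          refine add_le_add ih ?_
          rw [norm_mul, Complex.norm_real, Real.norm_eq_abs, abs_of_nonneg (by linarith)]
          exact mul_le_mul_of_nonneg_left h1 (by linarith)
        _ = _ := by ring
  have h1 := hB N hN
  calc ‖∑ v ∈ Finset.Ico M N, a v * w v‖ =
      ‖(∑ v ∈ Finset.Ico M N, a v * w v - w N * ∑ v ∈ Finset.Ico M N, a v) +
        w N * ∑ v ∈ Finset.Ico M N, a v‖ := by congr 1; ring
    _ ≤ _ := norm_add_le _ _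
    _ ≤ B * (w M - w N) + w N * B := by
      refine add_le_add key ?_
      rw [norm_mul, Complex.norm_real, Real.norm_eq_abs, abs_of_nonneg (hw N)]
      exact mul_le_mul_of_nonneg_left h1 (hw N)
    _ = _ := by ring


/-- The simplex. -/
def Splx (k : ℕ) : Set (Fin k → ℝ) := {s : Fin k → ℝ | (∀ i, 0 ≤ s i) ∧ ∑ i, s i ≤ 1}

/-- The affine combination. -/
def affc {k : ℕ} (s : Fin k → ℝ) (l : Fin (k + 1) → ℝ) : ℝ :=
  (∑ i : Fin k, s i * l i.castSucc) + (1 - ∑ i : Fin k, s i) * l (Fin.last k)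

/-- The character `e^{ix}`. -/
noncomputable def ee (x : ℝ) : ℂ := Complex.exp (x * Complex.I)

lemma ee_norm (x : ℝ) : ‖ee x‖ = 1 := Complex.norm_exp_ofReal_mul_I x

lemma ee_add (x y : ℝ) : ee (x + y) = ee x * ee y := by
  unfold ee; rw [← Complex.exp_add]; push_cast; ring_nf

lemma ee_sum {ι : Type*} (s : Finset ι) (f : ι → ℝ) : ee (∑ i ∈ s, f i) = ∏ i ∈ s, ee (f i) := by
  unfold ee; rw [← Complex.exp_sum]; push_cast; rw [Finset.sum_mul]

lemma continuous_ee : Continuous ee := by unfold ee; fun_prop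

@[fun_prop]
lemma continuous_ee' {X : Type*} [TopologicalSpace X] {f : X → ℝ} (hf : Continuous f) :
    Continuous (fun x => ee (f x)) := continuous_ee.comp hf

@[fun_prop]
lemma measurable_ee' {X : Type*} [MeasurableSpace X] {f : X → ℝ} (hf : Measurable f) :
    Measurable (fun x => ee (f x)) := continuous_ee.measurable.comp hf

lemma splx_sub (k : ℕ) (v : ℝ) :
    {u : Fin k → ℝ | (∀ i, 0 ≤ u i) ∧ ∑ i, u i ≤ v} ⊆ Set.Icc 0 (fun _ => v) := by
  rintro u ⟨h1, h2⟩
  refine ⟨h1, fun i => le_trans ?_ h2⟩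
  exact Finset.single_le_sum (f := u) (fun j _ => h1 j) (Finset.mem_univ i)

lemma splx_meas (k : ℕ) (v : ℝ) :
    MeasurableSet {u : Fin k → ℝ | (∀ i, 0 ≤ u i) ∧ ∑ i, u i ≤ v} := by
  have : IsClosed {u : Fin k → ℝ | (∀ i, 0 ≤ u i) ∧ ∑ i, u i ≤ v} := by
    rw [Set.ofPred_and, Set.ofPred_forall]
    refine IsClosed.inter (isClosed_iInter fun i => ?_) ?_
    · exact isClosed_le (by fun_prop) (by fun_prop)
    · exact isClosed_le (by fun_prop) (by fun_prop)
  exact this.measurableSet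

lemma splx_fin (k : ℕ) (v : ℝ) :
    volume {u : Fin k → ℝ | (∀ i, 0 ≤ u i) ∧ ∑ i, u i ≤ v} ≠ ∞ :=
  ne_top_of_le_ne_top (isCompact_Icc.measure_lt_top (μ := volume)).ne (measure_mono (splx_sub k v))

lemma simplex_scale (k : ℕ) (ω : ℝ) (v : ℕ) (hv : 1 ≤ v) (l : Fin (k + 1) → ℝ) :
    ∫ s in Splx k, ee (ω * v * affc s l) =
    ∫ u, {u : Fin k → ℝ | (∀ i, 0 ≤ u i) ∧ ∑ i, u i ≤ (v : ℝ)}.indicator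
      (fun u => (((v : ℝ) ^ k)⁻¹ : ℝ) *
        ee (ω * (∑ i, u i * l i.castSucc + (v - ∑ i, u i) * l (Fin.last k)))) u := by
  have hv0 : (0 : ℝ) < v := by exact_mod_cast hv
  set F : (Fin k → ℝ) → ℂ := {u : Fin k → ℝ | (∀ i, 0 ≤ u i) ∧ ∑ i, u i ≤ (v : ℝ)}.indicator
      (fun u => ee (ω * (∑ i, u i * l i.castSucc + (v - ∑ i, u i) * l (Fin.last k)))) with hF
  have h1 := Measure.integral_comp_smul (volume : Measure (Fin k → ℝ)) F (v : ℝ)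
  rw [abs_of_pos (by positivity)] at h1
  have h2 : ∫ s in Splx k, ee (ω * v * affc s l) = ∫ s, F ((v : ℝ) • s) := by
    have hm : MeasurableSet (Splx k) := splx_meas k 1
    rw [← integral_indicator hm]
    congr 1
    ext s
    have : (s ∈ Splx k) ↔ (v : ℝ) • s ∈ {u : Fin k → ℝ | (∀ i, 0 ≤ u i) ∧ ∑ i, u i ≤ (v : ℝ)} := by
      simp only [Splx, Set.mem_ofPred_eq, Pi.smul_apply, smul_eq_mul, ← Finset.mul_sum]
      refine and_congr (forall_congr' fun i => ?_) ?_
      · exact (mul_nonneg_iff_of_pos_left hv0).symm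
      · exact (mul_le_iff_le_one_right hv0).symm
    by_cases h : s ∈ Splx k
    · rw [Set.indicator_of_mem h, hF, Set.indicator_of_mem (this.1 h)]
      congr 1
      simp only [affc, Pi.smul_apply, smul_eq_mul, ← Finset.mul_sum, mul_assoc]
      ring
    · rw [Set.indicator_of_notMem h, hF, Set.indicator_of_notMem (fun h' => h (this.2 h'))]
  rw [h2, h1]
  simp only [Module.finrank_fintype_fun_eq_card, Fintype.card_fin]
  rw [← integral_smul]
  congr 1
  ext u
  rw [hF]
  simp only [Set.indicator_apply, Complex.real_smul]
  split_ifs <;> simp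

/-- Weighted partial sums. -/
noncomputable def WN (c : ℕ → ℂ) (k : ℕ) (ω : ℝ) (N m : ℕ) (x : ℝ) : ℂ :=
  ∑ v ∈ Finset.Ico (max m 1) N, (c v * ee (ω * v * x)) * (((v : ℝ) ^ k)⁻¹ : ℝ)

lemma WN_formula (c : ℕ → ℂ) (k : ℕ) (ω : ℝ) (N : ℕ) (l : Fin (k + 1) → ℝ) :
    ∑ v ∈ Finset.Ico 1 N, c v * ∫ s in Splx k, ee (ω * v * affc s l) =
    ∫ u in {u : Fin k → ℝ | ∀ i, 0 ≤ u i}, (∏ i, ee (ω * u i * l i.castSucc)) *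
      (ee (-ω * (∑ i, u i) * l (Fin.last k)) * WN c k ω N ⌈∑ i, u i⌉₊ (l (Fin.last k))) := by
  have hm : MeasurableSet {u : Fin k → ℝ | ∀ i, 0 ≤ u i} := by
    have : IsClosed {u : Fin k → ℝ | ∀ i, 0 ≤ u i} := by
      rw [Set.ofPred_forall]
      exact isClosed_iInter fun i => isClosed_le (by fun_prop) (by fun_prop)
    exact this.measurableSet
  rw [← integral_indicator hm]
  have h1 : ∀ v ∈ Finset.Ico 1 N, c v * ∫ s in Splx k, ee (ω * v * affc s l) =
     ∫ u, {u : Fin k → ℝ | (∀ i, 0 ≤ u i) ∧ ∑ i, u i ≤ (v : ℝ)}.indicator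
      (fun u => c v * ((((v : ℝ) ^ k)⁻¹ : ℝ) *
        ee (ω * (∑ i, u i * l i.castSucc + (v - ∑ i, u i) * l (Fin.last k))))) u := by
    intro v hv
    rw [simplex_scale k ω v (Finset.mem_Ico.1 hv).1 l, ← integral_const_mul]
    congr 1
    ext u
    simp only [Set.indicator_apply]
    split_ifs <;> simp
  rw [Finset.sum_congr rfl h1, ← integral_finsetSum]
  · congr 1
    ext u
    by_cases hu : ∀ i, 0 ≤ u i
    · rw [Set.indicator_of_mem (show u ∈ {u : Fin k → ℝ | ∀ i, 0 ≤ u i} from hu)]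
      unfold WN
      have : Finset.Ico (max ⌈∑ i, u i⌉₊ 1) N = (Finset.Ico 1 N).filter (fun v : ℕ => ∑ i, u i ≤ (v : ℝ)) := by
        ext v
        simp only [Finset.mem_Ico, Finset.mem_filter, max_le_iff, Nat.ceil_le]
        tauto
      rw [this, Finset.sum_filter, Finset.mul_sum, Finset.mul_sum]
      apply Finset.sum_congr rfl
      intro v hv
      by_cases hvu : ∑ i, u i ≤ (v : ℝ)
      · rw [Set.indicator_of_mem (show u ∈ {u : Fin k → ℝ | (∀ i, 0 ≤ u i) ∧ ∑ i, u i ≤ (v : ℝ)} from ⟨hu, hvu⟩), if_pos hvu, ← ee_sum]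
        have : ω * (∑ i, u i * l i.castSucc + (v - ∑ i, u i) * l (Fin.last k)) =
          (∑ i, ω * u i * l i.castSucc) + (-ω * (∑ i, u i) * l (Fin.last k) + ω * v * l (Fin.last k)) := by
          simp only [mul_assoc, ← Finset.mul_sum]
          ring
        rw [this, ee_add, ee_add]
        ring
      · rw [Set.indicator_of_notMem (fun h => hvu h.2), if_neg hvu]
        simp
    · rw [Set.indicator_of_notMem (show u ∉ {u : Fin k → ℝ | ∀ i, 0 ≤ u i} from hu)]
      apply Finset.sum_eq_zero
      intro v _
      rw [Set.indicator_of_notMem (fun h => hu h.1)]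
  · intro v hv
    rw [integrable_indicator_iff (splx_meas k v)]
    refine Measure.integrableOn_of_bounded (M := ‖c v‖ * ‖(((v : ℝ) ^ k)⁻¹ : ℝ)‖) (splx_fin k v) ?_ ?_
    · apply Continuous.aestronglyMeasurable
      fun_prop
    · refine Eventually.of_forall fun u => ?_
      rw [norm_mul, norm_mul, ee_norm, mul_one, Complex.norm_real]

lemma WN_bound (c : ℕ → ℂ) (k : ℕ) (ω A δ : ℝ)
    (h : ∀ M N : ℕ, 1 ≤ M → M ≤ N → ∀ x : ℝ,
      ‖∑ v ∈ Finset.Ico M N, c v * ee (ω * v * x)‖ ≤ A * (M : ℝ) ^ (-δ)) (N m : ℕ) (x : ℝ) (hA : 0 ≤ A) :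
    ‖WN c k ω N m x‖ ≤ A * ((max m 1 : ℕ) : ℝ) ^ (-((k : ℝ) + δ)) := by
  have hpos : (0 : ℝ) < ((max m 1 : ℕ) : ℝ) := by
    exact_mod_cast lt_of_lt_of_le one_pos (le_max_right m 1)
  rcases le_total (max m 1) N with hN | hN
  · have := abel_bound (fun v => c v * ee (ω * v * x)) (fun v => ((v : ℝ) ^ k)⁻¹)
      (fun v => by positivity) (max m 1) ?_ (A * ((max m 1 : ℕ) : ℝ) ^ (-δ))
      (fun N hN => h _ N (le_max_right _ _) hN x) N hN
    · refine this.trans (le_of_eq ?_)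
      rw [neg_add, Real.rpow_add hpos, Real.rpow_neg hpos.le (k : ℝ), Real.rpow_natCast]
      ring
    · intro v hv
      have : (0 : ℝ) < v := lt_of_lt_of_le hpos (by exact_mod_cast hv)
      apply inv_anti₀ (by positivity)
      apply pow_le_pow_left₀ this.le
      push_cast; linarith
  · unfold WN
    rw [Finset.Ico_eq_empty_of_le hN]
    simp only [Finset.sum_empty, norm_zero]
    positivity

lemma WN_tendsto (c : ℕ → ℂ) (k : ℕ) (ω A δ : ℝ) (hA : 0 ≤ A) (hδ : 0 < δ)
    (h : ∀ M N : ℕ, 1 ≤ M → M ≤ N → ∀ x : ℝ,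
      ‖∑ v ∈ Finset.Ico M N, c v * ee (ω * v * x)‖ ≤ A * (M : ℝ) ^ (-δ)) (m : ℕ) (x : ℝ) :
    ∃ W : ℂ, Tendsto (fun N => WN c k ω N m x) atTop (nhds W) := by
  apply cauchySeq_tendsto_of_complete
  have ht : Tendsto (fun n : ℕ => A * ((max n 1 : ℕ) : ℝ) ^ (-((k : ℝ) + δ))) atTop (nhds 0) := by
    have h1 : Tendsto (fun n : ℕ => (n : ℝ) ^ (-((k : ℝ) + δ))) atTop (nhds 0) :=
      (tendsto_rpow_neg_atTop (by positivity)).comp tendsto_natCast_atTop_atTop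
    have h2 : Tendsto (fun n : ℕ => max n 1) atTop atTop :=
      tendsto_atTop_mono (fun n => le_max_left n 1) tendsto_id
    simpa using (h1.comp h2).const_mul A
  refine cauchySeq_of_le_tendsto_0' (fun n : ℕ => A * ((max n 1 : ℕ) : ℝ) ^ (-((k : ℝ) + δ)))
    (fun n n' hn => ?_) ht
  rw [dist_comm, dist_eq_norm]
  have hb := WN_bound c k ω A δ h
  by_cases h1 : max m 1 ≤ n
  · have : WN c k ω n' m x - WN c k ω n m x = WN c k ω n' n x := by
      unfold WN
      have hn1 : max n 1 = n := max_eq_left (le_trans (le_max_right m 1) h1)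
      rw [hn1, ← Finset.sum_Ico_consecutive _ h1 hn]
      ring
    rw [this]
    exact hb n' n x hA
  · have h2 : WN c k ω n m x = 0 := by
      unfold WN
      rw [Finset.Ico_eq_empty_of_le (by omega)]; simp
    rw [h2, sub_zero]
    refine (hb n' m x hA).trans (mul_le_mul_of_nonneg_left ?_ hA)
    apply Real.rpow_le_rpow_of_nonpos
    · exact_mod_cast lt_of_lt_of_le one_pos (le_max_right n 1)
    · have : max n 1 ≤ max m 1 := by omega
      exact_mod_cast this
    · have : (0 : ℝ) ≤ k := by positivity
      linarith


/-- The constant of the decomposition. -/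
noncomputable def Cdec (k : ℕ) (δ : ℝ) : ℝ≥0∞ :=
  ∫⁻ u : Fin k → ℝ, ENNReal.ofReal ((2 : ℝ) ^ ((k : ℝ) + δ) * (1 + ‖u‖) ^ (-((k : ℝ) + δ)))

lemma Cdec_int (k : ℕ) (δ : ℝ) (hδ : 0 < δ) : Integrable (fun u : Fin k → ℝ =>
    (2 : ℝ) ^ ((k : ℝ) + δ) * (1 + ‖u‖) ^ (-((k : ℝ) + δ))) := by
  apply Integrable.const_mul
  apply integrable_one_add_norm
  simp [hδ]

lemma Cdec_ne_top (k : ℕ) (δ : ℝ) (hδ : 0 < δ) : Cdec k δ ≠ ∞ := by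
  have := (Cdec_int k δ hδ).lintegral_lt_top
  exact this.ne

lemma ceil_bound {k : ℕ} {δ : ℝ} (hδ : 0 < δ) (u : Fin k → ℝ) (hu : ∀ i, 0 ≤ u i) :
    ((max ⌈∑ i, u i⌉₊ 1 : ℕ) : ℝ) ^ (-((k : ℝ) + δ)) ≤
      (2 : ℝ) ^ ((k : ℝ) + δ) * (1 + ‖u‖) ^ (-((k : ℝ) + δ)) := by
  have h1 : ‖u‖ ≤ ∑ i, u i := by
    rw [pi_norm_le_iff_of_nonneg (Finset.sum_nonneg fun i _ => hu i)]
    intro i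
    rw [Real.norm_of_nonneg (hu i)]
    exact Finset.single_le_sum (f := u) (fun j _ => hu j) (Finset.mem_univ i)
  have h2 : (1 + ‖u‖) / 2 ≤ ((max ⌈∑ i, u i⌉₊ 1 : ℕ) : ℝ) := by
    push_cast
    have a1 := Nat.le_ceil (∑ i, u i)
    have a2 := le_max_left (⌈∑ i, u i⌉₊ : ℝ) 1
    have a3 := le_max_right (⌈∑ i, u i⌉₊ : ℝ) 1
    linarith
  have hn : 0 ≤ ‖u‖ := norm_nonneg u
  have hk : (0 : ℝ) ≤ k := by positivity
  calc _ ≤ ((1 + ‖u‖) / 2) ^ (-((k : ℝ) + δ)) :=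
        Real.rpow_le_rpow_of_nonpos (by positivity) h2 (by linarith)
    _ = _ := by
      rw [Real.div_rpow (by positivity) (by norm_num), Real.rpow_neg (by norm_num : (0:ℝ) ≤ 2)]
      field_simp

lemma hasDec_series (r : ℝ) (k : ℕ) (c : ℕ → ℂ) (ω A δ : ℝ) (hA : 0 ≤ A) (hδ : 0 < δ)
    (h : ∀ M N : ℕ, 1 ≤ M → M ≤ N → ∀ x : ℝ,
      ‖∑ v ∈ Finset.Ico M N, c v * ee (ω * v * x)‖ ≤ A * (M : ℝ) ^ (-δ))
    (φ : (Fin (k + 1) → ℝ) → ℂ)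
    (hφ : ∀ l, Tendsto (fun N => ∑ v ∈ Finset.Ico 1 N, c v * ∫ s in Splx k, ee (ω * v * affc s l))
      atTop (nhds (φ l))) :
    HasDec r φ (ENNReal.ofReal A * Cdec k δ) := by
  choose W hW using WN_tendsto c k ω A δ hA hδ h
  have hWb : ∀ m x, ‖W m x‖ ≤ A * ((max m 1 : ℕ) : ℝ) ^ (-((k : ℝ) + δ)) := fun m x =>
    le_of_tendsto (hW m x).norm (Eventually.of_forall fun N => WN_bound c k ω A δ h N m x hA)
  have hWm : ∀ m, Measurable (W m) := by
    intro m
    refine measurable_of_tendsto_metrizable (f := fun N x => WN c k ω N m x) (fun N => ?_)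
      (tendsto_pi_nhds.2 fun x => hW m x)
    apply Continuous.measurable
    unfold WN
    fun_prop
  have hm : MeasurableSet {u : Fin k → ℝ | ∀ i, 0 ≤ u i} := by
    have : IsClosed {u : Fin k → ℝ | ∀ i, 0 ≤ u i} := by
      rw [Set.ofPred_forall]
      exact isClosed_iInter fun i => isClosed_le (by fun_prop) (by fun_prop)
    exact this.measurableSet
  let Φ : Fin (k + 1) → (Set.Icc (-r) r : Set ℝ) × (Fin k → ℝ) → ℂ := fun i =>
    Fin.lastCases (motive := fun _ => (Set.Icc (-r) r : Set ℝ) × (Fin k → ℝ) → ℂ)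
      (fun p => ee (-ω * (∑ i, p.2 i) * p.1) * W ⌈∑ i, p.2 i⌉₊ p.1)
      (fun j p => ee (ω * p.2 j * p.1)) i
  have hΦl : ∀ p, Φ (Fin.last k) p = ee (-ω * (∑ i, p.2 i) * p.1) * W ⌈∑ i, p.2 i⌉₊ p.1 := by
    intro p; simp only [Φ, Fin.lastCases_last]
  have hΦc : ∀ j p, Φ (Fin.castSucc j) p = ee (ω * p.2 j * p.1) := by
    intro j p; simp only [Φ, Fin.lastCases_castSucc]
  have hΦlb : ∀ p, ‖Φ (Fin.last k) p‖ ≤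
      A * ((max ⌈∑ i, p.2 i⌉₊ 1 : ℕ) : ℝ) ^ (-((k : ℝ) + δ)) := by
    intro p
    rw [hΦl, norm_mul, ee_norm, one_mul]
    exact hWb _ _
  have hb : (∫⁻ σ in {u : Fin k → ℝ | ∀ i, 0 ≤ u i}, ∏ i, ⨆ ω, (‖Φ i (ω, σ)‖₊ : ℝ≥0∞))
      ≤ ENNReal.ofReal A * Cdec k δ := by
    unfold Cdec
    rw [← lintegral_const_mul' _ _ ENNReal.ofReal_ne_top]
    refine le_trans (setLIntegral_mono' hm fun u hu => ?_) (setLIntegral_le_lintegral _ _)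
    rw [← ENNReal.ofReal_mul hA, Fin.prod_univ_castSucc]
    have h1 : ∏ j : Fin k, ⨆ ω, (‖Φ j.castSucc (ω, u)‖₊ : ℝ≥0∞) ≤ 1 := by
      apply Finset.prod_le_one'
      intro j _
      apply iSup_le
      intro x
      rw [← enorm_eq_nnnorm, ← ofReal_norm, hΦc, ee_norm]
      simp
    refine le_trans (mul_le_mul_left h1 _) ?_
    rw [one_mul]
    apply iSup_le
    intro x
    rw [← enorm_eq_nnnorm, ← ofReal_norm]
    apply ENNReal.ofReal_le_ofReal
    refine (hΦlb _).trans (mul_le_mul_of_nonneg_left ?_ hA)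
    exact ceil_bound hδ u hu
  refine ⟨Fin k → ℝ, inferInstance, volume.restrict {u : Fin k → ℝ | ∀ i, 0 ≤ u i}, Φ,
    inferInstance, ?_, ?_, ?_, ?_, hb⟩
  · intro i
    refine Fin.lastCases ?_ (fun j => ?_) i
    · rw [show Φ (Fin.last k) = _ from funext hΦl]
      apply Measurable.mul
      · apply measurable_ee'
        fun_prop
      · have hW2 : Measurable (fun q : ℝ × ℕ => W q.2 q.1) :=
          measurable_from_prod_countable_left hWm
        have : Measurable (fun p : (Set.Icc (-r) r : Set ℝ) × (Fin k → ℝ) =>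
            ((p.1 : ℝ), ⌈∑ i, p.2 i⌉₊)) := by
          apply Measurable.prodMk
          · fun_prop
          · apply Nat.measurable_ceil.comp
            fun_prop
        exact hW2.comp this
    · rw [show Φ (Fin.castSucc j) = _ from funext (hΦc j)]
      apply measurable_ee'
      fun_prop
  · intro i u
    refine Fin.lastCases ?_ (fun j => ?_) i
    · exact ⟨A * ((max ⌈∑ i, u i⌉₊ 1 : ℕ) : ℝ) ^ (-((k : ℝ) + δ)), fun x => hΦlb (x, u)⟩
    · refine ⟨1, fun x => ?_⟩
      rw [hΦc, ee_norm]
  · exact ne_top_of_le_ne_top (ENNReal.mul_ne_top ENNReal.ofReal_ne_top (Cdec_ne_top k δ hδ)) hb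
  · intro x
    refine tendsto_nhds_unique (hφ _) ?_
    simp_rw [WN_formula]
    simp_rw [Fin.prod_univ_castSucc, hΦl, hΦc]
    refine tendsto_integral_of_dominated_convergence
      (fun u => A * ((2 : ℝ) ^ ((k : ℝ) + δ) * (1 + ‖u‖) ^ (-((k : ℝ) + δ)))) (fun N => ?_)
      (((Cdec_int k δ hδ).const_mul A).mono_measure Measure.restrict_le_self) (fun N => ?_) ?_
    · apply Measurable.aestronglyMeasurable
      apply Measurable.mul
      · apply Finset.measurable_fun_prod
        intro i _
        fun_prop
      · apply Measurable.mul
        · fun_prop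
        · have : Measurable (fun n : ℕ => WN c k ω N n (x (Fin.last k))) := measurable_from_nat
          apply this.comp
          apply Nat.measurable_ceil.comp
          fun_prop
    · rw [ae_restrict_iff' hm]
      refine Eventually.of_forall fun u hu => ?_
      rw [norm_mul, norm_mul, norm_prod]
      simp only [ee_norm, Finset.prod_const_one, one_mul]
      refine (WN_bound c k ω A δ h _ _ _ hA).trans (mul_le_mul_of_nonneg_left ?_ hA)
      exact ceil_bound hδ u hu
    · refine Eventually.of_forall fun u => ?_
      exact ((hW _ _).const_mul _).const_mul _


open AddCircle in
lemma circ_int {F : UnitAddCircle → ℂ} (hF : Continuous F) : Integrable F :=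
  hF.integrable_of_hasCompactSupport (HasCompactSupport.of_compactSpace F)

lemma circ_int' {F : UnitAddCircle → ℝ} (hF : Continuous F) : Integrable F :=
  hF.integrable_of_hasCompactSupport (HasCompactSupport.of_compactSpace F)

lemma circ_zero_null : (volume : Measure UnitAddCircle) {0} = 0 := by
  have := AddCircle.volume_closedBall (1 : ℝ) (x := 0) 0
  rw [Metric.closedBall_zero] at this
  rw [this]
  simp

lemma circ_rep (t : UnitAddCircle) : ∃ x : ℝ, (x : UnitAddCircle) = t ∧ |x| ≤ 1 / 2 ∧ ‖t‖ = |x| := by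
  induction t using QuotientAddGroup.induction_on with
  | H z =>
    refine ⟨z - round z, ?_, abs_sub_round z, UnitAddCircle.norm_eq⟩
    have : ((round z : ℝ) : UnitAddCircle) = 0 := by
      have := AddCircle.coe_period (1:ℝ)
      rw [AddCircle.coe_eq_zero_iff]
      exact ⟨round z, by simp⟩
    rw [AddCircle.coe_sub, this, sub_zero]

lemma fourier_norm_one (n : ℤ) (t : UnitAddCircle) : ‖fourier n t‖ = 1 := by
  rw [fourier_apply]; exact Circle.norm_coe _

lemma fourier_sub_one (t : UnitAddCircle) : 4 * ‖t‖ ≤ ‖fourier 1 t - 1‖ := by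
  obtain ⟨x, rfl, hx, hn⟩ := circ_rep t
  rw [hn, fourier_coe_apply]
  have : (2 * Real.pi * Complex.I * (1:ℤ) * x / (1:ℝ) : ℂ) = Complex.I * ((2 * Real.pi * x : ℝ) : ℂ) := by
    push_cast; ring
  rw [this, Complex.norm_exp_I_mul_ofReal_sub_one, norm_mul, Real.norm_eq_abs, Real.norm_eq_abs]
  have h1 : |Real.sin (2 * Real.pi * x / 2)| = Real.sin (Real.pi * |x|) := by
    have : 2 * Real.pi * x / 2 = Real.pi * x := by ring
    rw [this]
    have hp := Real.pi_pos
    rcases le_total 0 x with h | h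
    · rw [abs_of_nonneg h, abs_of_nonneg]
      apply Real.sin_nonneg_of_nonneg_of_le_pi (by positivity)
      rw [abs_of_nonneg h] at hx
      nlinarith
    · rw [abs_of_nonpos h, abs_of_nonpos, ← Real.sin_neg]
      · ring_nf
      rw [abs_of_nonpos h] at hx
      apply Real.sin_nonpos_of_nonpos_of_neg_pi_le
      · nlinarith
      · nlinarith
  rw [h1]
  have h2 := Real.mul_le_sin (x := Real.pi * |x|) (by positivity) (by nlinarith [Real.pi_pos])
  have h3 : 2 / Real.pi * (Real.pi * |x|) = 2 * |x| := by field_simp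
  rw [h3] at h2
  rw [abs_of_pos (by norm_num : (0:ℝ) < 2)]
  linarith

/-- one-sided Dirichlet kernel -/
noncomputable def Dk (n : ℕ) (t : UnitAddCircle) : ℂ := ∑ j ∈ Finset.range n, fourier (j : ℤ) t

lemma Dk_cont (n : ℕ) : Continuous (Dk n) := by unfold Dk; fun_prop

lemma Dk_le (n : ℕ) (t : UnitAddCircle) : ‖Dk n t‖ ≤ n := by
  unfold Dk
  refine (norm_sum_le _ _).trans ?_
  simp only [fourier_norm_one]
  simp

lemma Dk_le' (n : ℕ) (t : UnitAddCircle) : ‖Dk n t‖ * ‖t‖ ≤ 1 := by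
  have h1 : (fourier 1 t - 1) * Dk n t = fourier (n : ℤ) t - 1 := by
    unfold Dk
    induction n with
    | zero => simp
    | succ n ih =>
      rw [Finset.sum_range_succ, mul_add, ih]
      have : ((n + 1 : ℕ) : ℤ) = 1 + n := by push_cast; ring
      rw [this, fourier_add]
      ring
  have h2 : ‖(fourier 1 t - 1) * Dk n t‖ ≤ 2 := by
    rw [h1]
    refine (norm_sub_le _ _).trans ?_
    rw [fourier_norm_one]; norm_num
  rw [norm_mul] at h2
  have h3 := fourier_sub_one t
  have h4 : 4 * ‖t‖ * ‖Dk n t‖ ≤ 2 := (mul_le_mul_of_nonneg_right h3 (norm_nonneg _)).trans h2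
  nlinarith [norm_nonneg t, norm_nonneg (Dk n t)]

lemma Dk_interp (n : ℕ) (t : UnitAddCircle) (ht : t ≠ 0) (θ : ℝ) (h0 : 0 ≤ θ) (h1 : θ ≤ 1) :
    ‖Dk n t‖ ≤ (n : ℝ) ^ (1 - θ) * ‖t‖ ^ (-θ) := by
  have ht' : 0 < ‖t‖ := norm_pos_iff.2 ht
  have hD : ‖Dk n t‖ ≤ ‖t‖⁻¹ := by
    rw [← one_div, le_div_iff₀ ht']; exact Dk_le' n t
  rcases eq_or_lt_of_le (norm_nonneg (Dk n t)) with hz | hz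
  · rw [← hz]; positivity
  calc ‖Dk n t‖ = ‖Dk n t‖ ^ (1 - θ) * ‖Dk n t‖ ^ θ := by
        rw [← Real.rpow_add hz]; simp
    _ ≤ (n : ℝ) ^ (1 - θ) * (‖t‖⁻¹) ^ θ := by
        gcongr
        exact Dk_le n t
    _ = _ := by rw [Real.inv_rpow ht'.le, Real.rpow_neg ht'.le]

lemma circ_rpow_int (a : ℝ) (ha : 0 < a) : Integrable (fun t : UnitAddCircle => ‖t‖ ^ (a - 1)) := by
  have hmp := UnitAddCircle.measurePreserving_mk (-(1/2))
  rw [← hmp.integrable_comp]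
  · have : Integrable (fun x : ℝ => |x| ^ (a - 1)) (volume.restrict (Set.Ioc (-(1/2)) (-(1/2) + 1))) := by
      have h1 : IntervalIntegrable (fun x : ℝ => |x| ^ (a - 1)) volume 0 (1/2) := by
        have := intervalIntegral.intervalIntegrable_rpow' (a := 0) (b := 1/2) (r := a - 1) (by linarith)
        refine this.congr ?_
        intro x hx
        rw [Set.uIoc_of_le (by norm_num)] at hx
        simp only [abs_of_pos hx.1]
      have h2 : IntervalIntegrable (fun x : ℝ => |x| ^ (a - 1)) volume (-(1/2)) 0 := by
        have := h1.comp_sub_left 0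
        simp only [zero_sub, abs_neg, neg_zero] at this
        exact this.symm
      have h3 := h2.trans h1
      rw [intervalIntegrable_iff_integrableOn_Ioc_of_le (by norm_num)] at h3
      rw [show (-(1/2) + 1 : ℝ) = 1/2 by norm_num]
      exact h3
    refine this.congr ?_
    rw [EventuallyEq, ae_restrict_iff' measurableSet_Ioc]
    refine Eventually.of_forall fun x hx => ?_
    simp only [Function.comp]
    rw [(AddCircle.norm_coe_eq_abs_iff (1:ℝ) one_ne_zero).2]
    rw [abs_one, abs_le]
    exact ⟨hx.1.le, by linarith [hx.2]⟩
  · apply Measurable.aestronglyMeasurable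
    fun_prop

/-- integral constant -/
noncomputable def Jc (a : ℝ) : ℝ := ∫ t : UnitAddCircle, ‖t‖ ^ (a - 1)

lemma Jc_nonneg (a : ℝ) : 0 ≤ Jc a := integral_nonneg fun t => by positivity

lemma Dk_L1 (n : ℕ) (δ : ℝ) (h0 : 0 < δ) (h1 : δ ≤ 1) :
    ∫ t : UnitAddCircle, ‖Dk n t‖ ≤ (n : ℝ) ^ δ * Jc δ := by
  unfold Jc
  rw [← integral_const_mul]
  apply integral_mono_ae (circ_int' (Dk_cont n).norm) ((circ_rpow_int δ h0).const_mul _)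
  have : ∀ᵐ t : UnitAddCircle, t ≠ 0 := by
    simp [ae_iff, circ_zero_null]
  filter_upwards [this] with t ht
  have := Dk_interp n t ht (1 - δ) (by linarith) (by linarith)
  simpa using this

lemma Dk_sq (n : ℕ) (hn : 1 ≤ n) (ε : ℝ) (h0 : 0 < ε) (h1 : ε ≤ 1) :
    ∫ t : UnitAddCircle, ‖Dk n t‖ ^ 2 / n * ‖t‖ ^ ε ≤ (n : ℝ) ^ (-(ε/2)) * Jc (ε/2) := by
  unfold Jc
  rw [← integral_const_mul]
  have hn0 : (0 : ℝ) < n := by exact_mod_cast hn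
  apply integral_mono_ae (circ_int' ?_) ((circ_rpow_int (ε/2) (by linarith)).const_mul _)
  · have : ∀ᵐ t : UnitAddCircle, t ≠ 0 := by
      simp [ae_iff, circ_zero_null]
    filter_upwards [this] with t ht
    have ht' : 0 < ‖t‖ := norm_pos_iff.2 ht
    have := Dk_interp n t ht ((1 + ε/2)/2) (by linarith) (by linarith)
    calc ‖Dk n t‖ ^ 2 / n * ‖t‖ ^ ε ≤
        ((n : ℝ) ^ (1 - ((1 + ε/2)/2)) * ‖t‖ ^ (-((1 + ε/2)/2))) ^ 2 / n * ‖t‖ ^ ε := by gcongr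
      _ = ((n : ℝ) ^ (1 - ((1 + ε/2)/2)) * (n : ℝ) ^ (1 - ((1 + ε/2)/2)) * (n : ℝ) ^ (-1 : ℝ)) *
          (‖t‖ ^ (-((1 + ε/2)/2)) * ‖t‖ ^ (-((1 + ε/2)/2)) * ‖t‖ ^ ε) := by
          rw [Real.rpow_neg_one]; ring
      _ = _ := by
          rw [← Real.rpow_add hn0, ← Real.rpow_add hn0, ← Real.rpow_add ht', ← Real.rpow_add ht']
          congr 2 <;> ring
  · have := Dk_cont n
    have h2 : Continuous (fun t : UnitAddCircle => ‖t‖ ^ ε) :=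
      continuous_norm.rpow_const (fun _ => Or.inr h0.le)
    fun_prop


/-- Fourier coefficient -/
noncomputable def cf (G : UnitAddCircle → ℂ) (n : ℤ) : ℂ := ∫ t : UnitAddCircle, G t * fourier (-n) t

lemma int_fourier (n : ℤ) : ∫ t : UnitAddCircle, (fourier n t : ℂ) = if n = 0 then 1 else 0 := by
  split_ifs with h
  · subst h
    simp only [fourier_zero, integral_const]
    simp [measureReal_def]
  · have h1 : ∫ t : UnitAddCircle, (fourier n t : ℂ) =
        ∫ t : UnitAddCircle, (fourier n (t + ((1 / 2 / n : ℝ) : UnitAddCircle)) : ℂ) :=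
      (integral_add_right_eq_self (fun t => (fourier n t : ℂ)) _).symm
    have h2 : ∀ t : UnitAddCircle, fourier n (t + ((1 / 2 / n : ℝ) : UnitAddCircle)) = - fourier n t :=
      fun t => fourier_add_half_inv_index h one_pos t
    simp only [h2, integral_neg] at h1
    have h3 : (2 : ℂ) * ∫ t : UnitAddCircle, (fourier n t : ℂ) = 0 := by linear_combination h1
    simpa using h3

lemma fourier_sub' (n : ℤ) (x t : UnitAddCircle) :
    (fourier n (x - t) : ℂ) = fourier n x * fourier (-n) t := by
  rw [fourier_apply, smul_sub, sub_eq_add_neg, AddCircle.toCircle_add, fourier_apply, fourier_apply]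
  simp

lemma cf_fourier (n m : ℤ) : cf (fun t => fourier m t) n = if n = m then 1 else 0 := by
  unfold cf
  simp_rw [← fourier_add]
  rw [int_fourier]
  congr 1
  exact propext ⟨fun h => by omega, fun h => by omega⟩

/-- partial sum operator, frequencies `a, ..., a+n-1` -/
noncomputable def Sop (a : ℤ) (n : ℕ) (G : UnitAddCircle → ℂ) (x : UnitAddCircle) : ℂ :=
  ∑ j ∈ Finset.range n, cf G (a + j) * fourier (a + j) x

lemma Sop_eq (a : ℤ) (n : ℕ) {G : UnitAddCircle → ℂ} (hG : Continuous G) (x : UnitAddCircle) :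
    Sop a n G x = ∫ t : UnitAddCircle, G t * (fourier a (x - t) * Dk n (x - t)) := by
  unfold Sop cf Dk
  simp_rw [Finset.mul_sum]
  rw [integral_finsetSum]
  · apply Finset.sum_congr rfl
    intro j _
    rw [← integral_mul_const]
    congr 1
    ext t
    rw [← fourier_add, fourier_sub']
    ring
  · intro j _
    apply circ_int
    fun_prop

lemma Sop_bound (a : ℤ) (n : ℕ) {G : UnitAddCircle → ℂ} (hG : Continuous G) (B : ℝ)
    (hB : ∀ t, ‖G t‖ ≤ B) (δ : ℝ) (h0 : 0 < δ) (h1 : δ ≤ 1) (x : UnitAddCircle) :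
    ‖Sop a n G x‖ ≤ B * ((n : ℝ) ^ δ * Jc δ) := by
  have hB0 : 0 ≤ B := (norm_nonneg _).trans (hB 0)
  rw [Sop_eq a n hG]
  have hD := Dk_cont n
  calc _ ≤ ∫ t : UnitAddCircle, B * ‖Dk n (x - t)‖ := by
        apply norm_integral_le_of_norm_le
        · apply circ_int'; fun_prop
        · refine Eventually.of_forall fun t => ?_
          rw [norm_mul, norm_mul, fourier_norm_one, one_mul]
          exact mul_le_mul_of_nonneg_right (hB t) (norm_nonneg _)
    _ = B * ∫ t : UnitAddCircle, ‖Dk n t‖ := by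
        rw [integral_const_mul, integral_sub_left_eq_self (fun t => ‖Dk n t‖)]
    _ ≤ _ := mul_le_mul_of_nonneg_left (Dk_L1 n δ h0 h1) hB0

lemma cf_sub {G H : UnitAddCircle → ℂ} (hG : Continuous G) (hH : Continuous H) (n : ℤ) :
    cf (fun t => G t - H t) n = cf G n - cf H n := by
  unfold cf
  simp_rw [sub_mul]
  rw [integral_sub]
  · apply circ_int; fun_prop
  · apply circ_int; fun_prop

lemma Sop_sub {G H : UnitAddCircle → ℂ} (hG : Continuous G) (hH : Continuous H) (a : ℤ) (n : ℕ)
    (x : UnitAddCircle) : Sop a n (fun t => G t - H t) x = Sop a n G x - Sop a n H x := by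
  unfold Sop
  simp_rw [cf_sub hG hH, sub_mul]
  rw [Finset.sum_sub_distrib]

/-- Fejer mean -/
noncomputable def Fej (M : ℕ) (G : UnitAddCircle → ℂ) (x : UnitAddCircle) : ℂ :=
  ∑ j ∈ Finset.range M, ∑ l ∈ Finset.range M,
    ((M : ℂ)⁻¹ * cf G ((j : ℤ) - l)) * fourier ((j : ℤ) - l) x

lemma Fej_cont (M : ℕ) (G : UnitAddCircle → ℂ) : Continuous (Fej M G) := by
  unfold Fej; fun_prop

lemma cf_Fej (M : ℕ) (G : UnitAddCircle → ℂ) (n : ℤ) : cf (Fej M G) n =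
    ∑ j ∈ Finset.range M, ∑ l ∈ Finset.range M,
    ((M : ℂ)⁻¹ * cf G ((j : ℤ) - l)) * if n = (j : ℤ) - l then 1 else 0 := by
  simp_rw [← cf_fourier]
  have hc : ∀ (H : UnitAddCircle → ℂ), cf H n = ∫ t : UnitAddCircle, H t * fourier (-n) t :=
    fun _ => rfl
  rw [hc]
  unfold Fej
  simp_rw [Finset.sum_mul]
  rw [integral_finsetSum]
  · apply Finset.sum_congr rfl
    intro j _
    rw [integral_finsetSum]
    · apply Finset.sum_congr rfl
      intro l _
      rw [hc, ← integral_const_mul]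
      congr 1
      ext t
      ring
    · intro l _
      apply circ_int
      fun_prop
  · intro j _
    apply circ_int
    fun_prop

lemma Sop_Fej_zero (M : ℕ) (G : UnitAddCircle → ℂ) (a : ℤ) (n : ℕ)
    (h : ∀ j < n, (M : ℤ) ≤ |a + j|) (x : UnitAddCircle) : Sop a n (Fej M G) x = 0 := by
  unfold Sop
  apply Finset.sum_eq_zero
  intro i hi
  rw [cf_Fej, Finset.sum_eq_zero, zero_mul]
  intro j hj
  apply Finset.sum_eq_zero
  intro l hl
  have := h i (Finset.mem_range.1 hi)
  rw [Finset.mem_range] at hj hl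
  rw [if_neg, mul_zero]
  intro h2
  rw [h2] at this
  rcases abs_cases ((j : ℤ) - l) with h3 | h3 <;> omega

lemma Sop_Fej_id (M : ℕ) (G : UnitAddCircle → ℂ) (x : UnitAddCircle) :
    Sop (-M) (2 * M + 1) (Fej M G) x = Fej M G x := by
  unfold Sop
  simp_rw [cf_Fej, Finset.sum_mul]
  rw [Finset.sum_comm]
  unfold Fej
  apply Finset.sum_congr rfl
  intro j hj
  rw [Finset.sum_comm]
  apply Finset.sum_congr rfl
  intro l hl
  rw [Finset.mem_range] at hj hl
  obtain ⟨i, hi⟩ : ∃ i : ℕ, (i : ℤ) = (j : ℤ) - l + M := ⟨((j : ℤ) - l + M).toNat, by omega⟩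
  rw [Finset.sum_eq_single i]
  · have : -(M : ℤ) + i = (j : ℤ) - l := by omega
    rw [this]; simp
  · intro b _ hb
    rw [if_neg (by omega)]; simp
  · intro h
    rw [Finset.mem_range] at h
    omega

lemma Dk_sq_eq (M : ℕ) (t : UnitAddCircle) :
    ∑ j ∈ Finset.range M, ∑ l ∈ Finset.range M, (fourier ((j : ℤ) - l) t : ℂ)
      = ((‖Dk M t‖ ^ 2 : ℝ) : ℂ) := by
  have : ((‖Dk M t‖ ^ 2 : ℝ) : ℂ) = Dk M t * (starRingEnd ℂ) (Dk M t) := by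
    rw [Complex.mul_conj, Complex.normSq_eq_norm_sq]
  rw [this]
  unfold Dk
  rw [map_sum, Finset.sum_mul_sum]
  apply Finset.sum_congr rfl
  intro j _
  apply Finset.sum_congr rfl
  intro l _
  rw [← fourier_neg, ← fourier_add, sub_eq_add_neg]

lemma Fej_kernel_one (M : ℕ) (hM : 1 ≤ M) :
    ∫ t : UnitAddCircle, ((‖Dk M t‖ ^ 2 / M : ℝ) : ℂ) = 1 := by
  have h : ∀ t : UnitAddCircle, ((‖Dk M t‖ ^ 2 / M : ℝ) : ℂ) = (∑ j ∈ Finset.range M, ∑ l ∈ Finset.range M, (fourier ((j : ℤ) - l) t : ℂ)) * (M : ℂ)⁻¹ := by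
    intro t
    rw [Dk_sq_eq]; push_cast; rfl
  simp_rw [h]
  rw [integral_mul_const, integral_finsetSum]
  · have : ∀ j ∈ Finset.range M, ∫ t : UnitAddCircle, ∑ l ∈ Finset.range M, (fourier ((j : ℤ) - l) t : ℂ) = 1 := by
      intro j hj
      rw [integral_finsetSum]
      · simp_rw [int_fourier]
        rw [Finset.sum_eq_single j]
        · simp
        · intro b _ hb
          rw [if_neg (by omega)]
        · intro h; exact absurd hj h
      · intro l _
        apply circ_int; fun_prop
    rw [Finset.sum_congr rfl this]
    simp
    have : (M : ℂ) ≠ 0 := by exact_mod_cast (by omega : M ≠ 0)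
    field_simp
  · intro j _
    apply circ_int; fun_prop

lemma Fej_eq (M : ℕ) {G : UnitAddCircle → ℂ} (hG : Continuous G) (x : UnitAddCircle) :
    Fej M G x = ∫ t : UnitAddCircle, G (x - t) * ((‖Dk M t‖ ^ 2 / M : ℝ) : ℂ) := by
  rw [← integral_sub_left_eq_self (fun t => G (x - t) * ((‖Dk M t‖ ^ 2 / M : ℝ) : ℂ)) _ x]
  simp only [sub_sub_cancel]
  have h : ∀ t : UnitAddCircle, G t * ((‖Dk M (x - t)‖ ^ 2 / M : ℝ) : ℂ) =
     ∑ j ∈ Finset.range M, ∑ l ∈ Finset.range M, G t * (M : ℂ)⁻¹ * (fourier ((j : ℤ) - l) x * fourier (-((j : ℤ) - l)) t) := by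
    intro t
    simp_rw [← fourier_sub', ← Finset.mul_sum]
    rw [Dk_sq_eq]; push_cast; ring
  simp_rw [h]
  unfold Fej cf
  rw [integral_finsetSum]
  · apply Finset.sum_congr rfl
    intro j _
    rw [integral_finsetSum]
    · apply Finset.sum_congr rfl
      intro l _
      rw [← integral_const_mul, ← integral_mul_const]
      congr 1
      ext t
      ring
    · intro l _
      apply circ_int; fun_prop
  · intro j _
    apply circ_int; fun_prop

lemma Fej_approx (M : ℕ) (hM : 1 ≤ M) {G : UnitAddCircle → ℂ} (hG : Continuous G) (η ε : ℝ)
    (h0 : 0 < ε) (h1 : ε ≤ 1) (hη : 0 ≤ η)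
    (hH : ∀ x y, ‖G x - G y‖ ≤ η * ‖x - y‖ ^ ε) (x : UnitAddCircle) :
    ‖G x - Fej M G x‖ ≤ η * ((M : ℝ) ^ (-(ε/2)) * Jc (ε/2)) := by
  have hD := Dk_cont M
  have h2 : Continuous (fun t : UnitAddCircle => ‖t‖ ^ ε) :=
      continuous_norm.rpow_const (fun _ => Or.inr h0.le)
  have e : G x - Fej M G x = ∫ t : UnitAddCircle, (G x - G (x - t)) * ((‖Dk M t‖ ^ 2 / M : ℝ) : ℂ) := by
    simp_rw [sub_mul]
    rw [integral_sub, integral_const_mul, Fej_kernel_one M hM, mul_one, Fej_eq M hG]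
    · apply circ_int; fun_prop
    · apply circ_int; fun_prop
  rw [e]
  calc _ ≤ ∫ t : UnitAddCircle, η * (‖Dk M t‖ ^ 2 / M * ‖t‖ ^ ε) := by
        apply norm_integral_le_of_norm_le
        · apply circ_int'; fun_prop
        · refine Eventually.of_forall fun t => ?_
          have := hH x (x - t)
          rw [sub_sub_cancel] at this
          rw [norm_mul, Complex.norm_real, Real.norm_of_nonneg (by positivity)]
          calc _ ≤ η * ‖t‖ ^ ε * (‖Dk M t‖ ^ 2 / M) := mul_le_mul_of_nonneg_right this (by positivity)
            _ = _ := by ring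
    _ ≤ _ := by
      rw [integral_const_mul]
      exact mul_le_mul_of_nonneg_left (Dk_sq M hM ε h0 h1) hη


lemma Sop_high (M : ℕ) (hM : 1 ≤ M) {G : UnitAddCircle → ℂ} (hG : Continuous G) (η ε : ℝ)
    (h0 : 0 < ε) (h1 : ε ≤ 1) (hη : 0 ≤ η)
    (hH : ∀ x y, ‖G x - G y‖ ≤ η * ‖x - y‖ ^ ε) (a : ℤ) (n : ℕ) (hn : n ≤ M)
    (ha : ∀ j < n, (M : ℤ) ≤ |a + j|) (x : UnitAddCircle) :
    ‖Sop a n G x‖ ≤ Jc (ε/2) * Jc (ε/4) * η * (M : ℝ) ^ (-(ε/4)) := by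
  have hM0 : (0 : ℝ) < M := by exact_mod_cast hM
  have e : Sop a n G x = Sop a n (fun t => G t - Fej M G t) x := by
    rw [Sop_sub hG (Fej_cont M G), Sop_Fej_zero M G a n ha, sub_zero]
  rw [e]
  refine (Sop_bound a n (hG.sub (Fej_cont M G)) _ (Fej_approx M hM hG η ε h0 h1 hη hH) (ε/4)
    (by linarith) (by linarith) x).trans ?_
  have j1 := Jc_nonneg (ε/2)
  have j2 := Jc_nonneg (ε/4)
  calc _ ≤ η * ((M : ℝ) ^ (-(ε/2)) * Jc (ε/2)) * ((M : ℝ) ^ (ε/4) * Jc (ε/4)) := by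
        gcongr
    _ = Jc (ε/2) * Jc (ε/4) * η * ((M : ℝ) ^ (-(ε/2)) * (M : ℝ) ^ (ε/4)) := by ring
    _ = _ := by
      rw [← Real.rpow_add hM0]
      congr 2
      ring

lemma Sop_tendsto {G : UnitAddCircle → ℂ} (hG : Continuous G) (η ε : ℝ)
    (h0 : 0 < ε) (h1 : ε ≤ 1) (hη : 0 ≤ η)
    (hH : ∀ x y, ‖G x - G y‖ ≤ η * ‖x - y‖ ^ ε) (x : UnitAddCircle) :
    Tendsto (fun M : ℕ => Sop (-M) (2 * M + 1) G x) atTop (nhds (G x)) := by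
  have j1 := Jc_nonneg (ε/2)
  have j2 := Jc_nonneg (ε/4)
  rw [tendsto_iff_norm_sub_tendsto_zero]
  have ht : ∀ a : ℝ, 0 < a → Tendsto (fun n : ℕ => (n : ℝ) ^ (-a)) atTop (nhds 0) := fun a ha =>
      (tendsto_rpow_neg_atTop ha).comp tendsto_natCast_atTop_atTop
  have hlim : Tendsto (fun M : ℕ => η * Jc (ε/2) * (M : ℝ) ^ (-(ε/2)) +
      η * Jc (ε/2) * (3 : ℝ) ^ (ε/4) * Jc (ε/4) * (M : ℝ) ^ (-(ε/4))) atTop (nhds 0) := by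
    have := ((ht (ε/2) (by linarith)).const_mul (η * Jc (ε/2))).add
      ((ht (ε/4) (by linarith)).const_mul (η * Jc (ε/2) * (3 : ℝ) ^ (ε/4) * Jc (ε/4)))
    simpa using this
  refine squeeze_zero' (Eventually.of_forall fun _ => norm_nonneg _) ?_ hlim
  filter_upwards [eventually_ge_atTop 1] with M hM
  have hM0 : (1 : ℝ) ≤ M := by exact_mod_cast hM
  have e : Sop (-M) (2 * M + 1) G x - G x =
      -(G x - Fej M G x) + Sop (-M) (2 * M + 1) (fun t => G t - Fej M G t) x := by
    rw [Sop_sub hG (Fej_cont M G), Sop_Fej_id]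
    ring
  rw [e]
  have b1 := Fej_approx M hM hG η ε h0 h1 hη hH
  have b2 := Sop_bound (-M) (2 * M + 1) (hG.sub (Fej_cont M G)) _ b1 (ε/4)
    (by linarith) (by linarith) x
  refine (norm_add_le _ _).trans (add_le_add ?_ (b2.trans ?_))
  · rw [norm_neg]
    refine (b1 x).trans (le_of_eq (by ring))
  · calc _ ≤ η * ((M : ℝ) ^ (-(ε/2)) * Jc (ε/2)) * ((3 * M : ℝ) ^ (ε/4) * Jc (ε/4)) := by
          gcongr
          push_cast; linarith
      _ = η * Jc (ε/2) * (3 : ℝ) ^ (ε/4) * Jc (ε/4) * ((M : ℝ) ^ (-(ε/2)) * (M : ℝ) ^ (ε/4)) := by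
          rw [Real.mul_rpow (by norm_num) (by linarith)]
          ring
      _ = _ := by
        rw [← Real.rpow_add (by linarith)]
        congr 2
        ring

/-- tail constant -/
noncomputable def Ac (ε : ℝ) : ℝ := Jc (ε/2) * Jc (ε/4) / (1 - (2 : ℝ) ^ (-(ε/4)))

lemma Ac_den {ε : ℝ} (h0 : 0 < ε) : 0 < 1 - (2 : ℝ) ^ (-(ε/4)) := by
  have : (2 : ℝ) ^ (-(ε/4)) < 1 := Real.rpow_lt_one_of_one_lt_of_neg (by norm_num) (by linarith)
  linarith

lemma Ac_nonneg {ε : ℝ} (h0 : 0 < ε) : 0 ≤ Ac ε :=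
  div_nonneg (mul_nonneg (Jc_nonneg _) (Jc_nonneg _)) (Ac_den h0).le

lemma tail_pos {G : UnitAddCircle → ℂ} (hG : Continuous G) (η ε : ℝ)
    (h0 : 0 < ε) (h1 : ε ≤ 1) (hη : 0 ≤ η)
    (hH : ∀ x y, ‖G x - G y‖ ≤ η * ‖x - y‖ ^ ε) (x : UnitAddCircle) (d : ℕ) :
    ∀ M N : ℕ, 1 ≤ M → M ≤ N → N - M ≤ d →
    ‖∑ v ∈ Finset.Ico M N, cf G v * fourier (v : ℤ) x‖ ≤ Ac ε * η * (M : ℝ) ^ (-(ε/4)) := by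
  have j1 := Jc_nonneg (ε/2)
  have j2 := Jc_nonneg (ε/4)
  have hden := Ac_den h0
  have hA : Jc (ε/2) * Jc (ε/4) = Ac ε * (1 - (2 : ℝ) ^ (-(ε/4))) := by
    unfold Ac; field_simp
  have hA0 := Ac_nonneg h0
  have base : ∀ M N : ℕ, 1 ≤ M → M ≤ N → N ≤ 2 * M →
    ‖∑ v ∈ Finset.Ico M N, cf G v * fourier (v : ℤ) x‖ ≤
      Jc (ε/2) * Jc (ε/4) * η * (M : ℝ) ^ (-(ε/4)) := by
    intro M N hM hN hN2
    have : ∑ v ∈ Finset.Ico M N, cf G v * fourier (v : ℤ) x = Sop M (N - M) G x := by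
      rw [Finset.sum_Ico_eq_sum_range]
      unfold Sop
      push_cast
      rfl
    rw [this]
    apply Sop_high M hM hG η ε h0 h1 hη hH _ _ (by omega)
    intro j _
    rw [abs_of_nonneg (by omega)]
    omega
  induction d with
  | zero =>
    intro M N hM hN hd
    have : N = M := by omega
    subst this
    simp only [Finset.Ico_self, Finset.sum_empty, norm_zero]
    positivity
  | succ d ih =>
    intro M N hM hN hd
    by_cases h2 : N ≤ 2 * M
    · refine (base M N hM hN h2).trans ?_
      have : Jc (ε/2) * Jc (ε/4) ≤ Ac ε := by
        rw [hA]
        have : 0 ≤ (2 : ℝ) ^ (-(ε/4)) := by positivity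
        nlinarith
      gcongr
    · rw [← Finset.sum_Ico_consecutive _ (show M ≤ 2 * M by omega) (show 2 * M ≤ N by omega)]
      refine (norm_add_le _ _).trans ?_
      have b1 := base M (2 * M) hM (by omega) le_rfl
      have b2 := ih (2 * M) N (by omega) (by omega) (by omega)
      refine (add_le_add b1 b2).trans (le_of_eq ?_)
      push_cast
      rw [hA, Real.mul_rpow (by norm_num) (by positivity)]
      ring

lemma cf_neg (G : UnitAddCircle → ℂ) (n : ℤ) : cf (fun t => G (-t)) n = cf G (-n) := by
  unfold cf
  rw [← integral_neg_eq_self (fun t => G t * fourier (- -n) t)]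
  congr 1
  ext t
  congr 1
  simp [fourier_apply]

lemma tail_neg {G : UnitAddCircle → ℂ} (hG : Continuous G) (η ε : ℝ)
    (h0 : 0 < ε) (h1 : ε ≤ 1) (hη : 0 ≤ η)
    (hH : ∀ x y, ‖G x - G y‖ ≤ η * ‖x - y‖ ^ ε) (x : UnitAddCircle)
    (M N : ℕ) (hM : 1 ≤ M) (hN : M ≤ N) :
    ‖∑ v ∈ Finset.Ico M N, cf G (-v) * fourier (-(v : ℤ)) x‖ ≤ Ac ε * η * (M : ℝ) ^ (-(ε/4)) := by
  have := tail_pos (G := fun t => G (-t)) (by fun_prop) η ε h0 h1 hη (fun x y => ?_) (-x) (N - M) M N hM hN le_rfl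
  · convert this using 4 with v hv
    · rw [cf_neg]
    · simp [fourier_apply]
  · refine (hH (-x) (-y)).trans (le_of_eq ?_)
    rw [← norm_neg (x - y)]
    congr 3
    abel

lemma Sop_split (G : UnitAddCircle → ℂ) (M : ℕ) (x : UnitAddCircle) :
    Sop (-M) (2 * M + 1) G x = cf G 0 + ∑ v ∈ Finset.Ico 1 (M + 1), cf G v * fourier (v : ℤ) x +
      ∑ v ∈ Finset.Ico 1 (M + 1), cf G (-v) * fourier (-(v : ℤ)) x := by
  unfold Sop
  have e : 2 * M + 1 = M + (M + 1) := by ring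
  rw [e, Finset.sum_range_add, ← Finset.sum_range_reflect, Finset.sum_range_succ']
  rw [Finset.sum_Ico_eq_sum_range, Finset.sum_Ico_eq_sum_range]
  have a1 : ∑ j ∈ Finset.range M, cf G (-(M : ℤ) + (M - 1 - j : ℕ)) * fourier (-(M : ℤ) + (M - 1 - j : ℕ)) x =
    ∑ k ∈ Finset.range (M + 1 - 1), cf G (-((1 + k : ℕ) : ℤ)) * fourier (-((1 + k : ℕ) : ℤ)) x := by
    apply Finset.sum_congr (by simp)
    intro j hj
    rw [Finset.mem_range] at hj
    have : -(M : ℤ) + (M - 1 - j : ℕ) = (-((1 + j : ℕ) : ℤ)) := by omega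
    rw [this]
  have a2 : ∑ j ∈ Finset.range M, cf G (-(M : ℤ) + (M + (j + 1) : ℕ)) * fourier (-(M : ℤ) + (M + (j + 1) : ℕ)) x =
    ∑ k ∈ Finset.range (M + 1 - 1), cf G (((1 + k : ℕ) : ℤ)) * fourier (((1 + k : ℕ) : ℤ)) x := by
    apply Finset.sum_congr (by simp)
    intro j hj
    have : -(M : ℤ) + (M + (j + 1) : ℕ) = (((1 + j : ℕ) : ℤ)) := by omega
    rw [this]
  rw [a1, a2]
  have : -(M : ℤ) + (M + 0 : ℕ) = 0 := by omega
  rw [this, fourier_zero]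
  ring


lemma continuous_affc {k : ℕ} (l : Fin (k + 1) → ℝ) : Continuous (fun s : Fin k → ℝ => affc s l) := by
  unfold affc; fun_prop

lemma affc_mem {k : ℕ} {r : ℝ} {s : Fin k → ℝ} (hs : s ∈ Splx k) {l : Fin (k + 1) → ℝ}
    (hl : ∀ i, l i ∈ Set.Icc (-r) r) : affc s l ∈ Set.Icc (-r) r := by
  obtain ⟨h1, h2⟩ := hs
  have e : ∀ a : ℝ, a = ∑ i, s i * a + (1 - ∑ i, s i) * a := by
    intro a; rw [← Finset.sum_mul]; ring
  unfold affc
  constructor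
  · rw [e (-r)]
    gcongr with i
    · exact h1 i
    · exact (hl _).1
    · exact (hl _).1
  · conv_rhs => rw [e r]
    gcongr with i
    · exact h1 i
    · exact (hl _).2
    · exact (hl _).2

lemma splx_finite (k : ℕ) : IsFiniteMeasure (volume.restrict (Splx k)) :=
  ⟨by rw [Measure.restrict_apply_univ]; exact (splx_fin k 1).lt_top⟩

lemma hasDec_side (r : ℝ) (k : ℕ) (c : ℕ → ℂ) (ω A δ : ℝ) (hA : 0 ≤ A) (hδ : 0 < δ)
    (h : ∀ M N : ℕ, 1 ≤ M → M ≤ N → ∀ x : ℝ,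
      ‖∑ v ∈ Finset.Ico M N, c v * ee (ω * v * x)‖ ≤ A * (M : ℝ) ^ (-δ)) :
    ∃ g : ℝ → ℂ, Measurable g ∧ (∀ x, ‖g x‖ ≤ A) ∧
      (∀ x, Tendsto (fun N => ∑ v ∈ Finset.Ico 1 N, c v * ee (ω * v * x)) atTop (nhds (g x))) ∧
      HasDec r (fun l => ∫ s in Splx k, g (affc s l)) (ENNReal.ofReal A * Cdec k δ) := by
  have := splx_finite k
  have hb : ∀ N x, ‖∑ v ∈ Finset.Ico 1 N, c v * ee (ω * v * x)‖ ≤ A := by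
    intro N x
    rcases le_total 1 N with hN | hN
    · simpa using h 1 N le_rfl hN x
    · rw [Finset.Ico_eq_empty_of_le hN]; simpa using hA
  have hex : ∀ x, ∃ W : ℂ, Tendsto (fun N => ∑ v ∈ Finset.Ico 1 N, c v * ee (ω * v * x)) atTop (nhds W) := by
    intro x
    obtain ⟨W, hW⟩ := WN_tendsto c 0 ω A δ hA hδ h 0 x
    refine ⟨W, ?_⟩
    simpa [WN] using hW
  choose g hg using hex
  have hm : Measurable g := by
    refine measurable_of_tendsto_metrizable (f := fun N x => ∑ v ∈ Finset.Ico 1 N, c v * ee (ω * v * x)) (fun N => ?_) (tendsto_pi_nhds.2 hg)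
    fun_prop
  have hgb : ∀ x, ‖g x‖ ≤ A := fun x => le_of_tendsto (hg x).norm (Eventually.of_forall fun N => hb N x)
  refine ⟨g, hm, hgb, hg, hasDec_series r k c ω A δ hA hδ h _ fun l => ?_⟩
  have hc := continuous_affc l
  have e : ∀ N, ∑ v ∈ Finset.Ico 1 N, c v * ∫ s in Splx k, ee (ω * v * affc s l) =
      ∫ s in Splx k, ∑ v ∈ Finset.Ico 1 N, c v * ee (ω * v * affc s l) := by
    intro N
    rw [integral_finsetSum]
    · exact Finset.sum_congr rfl fun v _ => (integral_const_mul _ _).symm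
    · intro v _
      refine Integrable.const_mul ?_ _
      refine Integrable.of_bound (C := 1) (by fun_prop : Continuous fun s => ee (ω * v * affc s l)).aestronglyMeasurable ?_
      exact Eventually.of_forall fun s => (ee_norm _).le
  simp_rw [e]
  refine tendsto_integral_of_dominated_convergence (fun _ => A) (fun N => ?_) (integrable_const _) (fun N => ?_) ?_
  · exact (by fun_prop : Continuous fun s => ∑ v ∈ Finset.Ico 1 N, c v * ee (ω * v * affc s l)).aestronglyMeasurable
  · exact Eventually.of_forall fun s => hb N _
  · exact Eventually.of_forall fun s => hg _

lemma fourier_ee (r : ℝ) (n : ℤ) (x : ℝ) :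
    fourier n ((x / (4 * r) : ℝ) : UnitAddCircle) = ee (2 * Real.pi / (4 * r) * n * x) := by
  rw [fourier_coe_apply]
  unfold ee
  congr 1
  push_cast
  ring

lemma core (k : ℕ) (r ε : ℝ) (hr : 0 < r) (h0 : 0 < ε) (h1 : ε ≤ 1) :
    ∃ K : ℝ≥0∞, K ≠ ∞ ∧ ∀ (h : ℝ → ℂ) (η : ℝ), 0 ≤ η →
      (∀ x ∈ Set.Icc (-r) r, ‖h x‖ ≤ η) →
      (∀ x ∈ Set.Icc (-r) r, ∀ y ∈ Set.Icc (-r) r, ‖h x - h y‖ ≤ η * |x - y| ^ ε) →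
      HasDec r (fun l : Fin (k + 1) → ℝ => ∫ s in Splx k, h (affc s l)) (K * ENNReal.ofReal η) := by
  have := splx_finite k
  have hA0 := Ac_nonneg h0
  set B : ℝ := (4 * r) ^ ε with hB
  have hB0 : 0 ≤ B := by positivity
  set V : ℝ := volume.real (Splx k) with hV
  set D := ENNReal.ofReal (Ac ε * B) * Cdec k (ε / 4) with hD
  refine ⟨ENNReal.ofReal V + D + D, ?_, ?_⟩
  · have : D ≠ ∞ := ENNReal.mul_ne_top ENNReal.ofReal_ne_top (Cdec_ne_top k _ (by positivity))
    simp [this]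
  intro h η hη hbd hH
  set G : UnitAddCircle → ℂ := fun t => h (4 * r * ‖t + ((1 / 4 : ℝ) : UnitAddCircle)‖ - r) with hG
  have hmem : ∀ t : UnitAddCircle, 4 * r * ‖t + ((1 / 4 : ℝ) : UnitAddCircle)‖ - r ∈ Set.Icc (-r) r := by
    intro t
    have h2 : ‖t + ((1 / 4 : ℝ) : UnitAddCircle)‖ ≤ 1 / 2 := by
      have := AddCircle.norm_le_half_period (1 : ℝ) (x := t + ((1 / 4 : ℝ) : UnitAddCircle)) one_ne_zero
      simpa using this
    constructor
    · have : 0 ≤ 4 * r * ‖t + ((1 / 4 : ℝ) : UnitAddCircle)‖ := by positivity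
      linarith
    · nlinarith
  have hGb : ∀ t, ‖G t‖ ≤ η := fun t => hbd _ (hmem t)
  have hGH : ∀ x y, ‖G x - G y‖ ≤ (η * B) * ‖x - y‖ ^ ε := by
    intro x y
    refine (hH _ (hmem x) _ (hmem y)).trans ?_
    rw [mul_assoc η B, hB, ← Real.mul_rpow (by positivity) (by positivity)]
    gcongr
    have e : 4 * r * ‖x + ((1 / 4 : ℝ) : UnitAddCircle)‖ - r - (4 * r * ‖y + ((1 / 4 : ℝ) : UnitAddCircle)‖ - r)
      = 4 * r * (‖x + ((1 / 4 : ℝ) : UnitAddCircle)‖ - ‖y + ((1 / 4 : ℝ) : UnitAddCircle)‖) := by ring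
    rw [e, abs_mul, abs_of_pos (by positivity)]
    gcongr
    refine (abs_norm_sub_norm_le _ _).trans (le_of_eq ?_)
    congr 1; abel
  have hGc : Continuous G := by
    rw [continuous_iff_continuousAt]
    intro x
    rw [ContinuousAt, tendsto_iff_norm_sub_tendsto_zero]
    refine squeeze_zero (fun _ => norm_nonneg _) (fun y => hGH y x) ?_
    have : Continuous fun y : UnitAddCircle => η * B * ‖y - x‖ ^ ε :=
      continuous_const.mul ((continuous_norm.comp (continuous_id.sub continuous_const)).rpow_const fun _ => Or.inr h0.le)
    have := this.tendsto x
    simpa [Real.zero_rpow h0.ne'] using this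
  have hGv : ∀ x ∈ Set.Icc (-r) r, G ((x / (4 * r) : ℝ) : UnitAddCircle) = h x := by
    intro x hx
    have h5 : -(1/4) ≤ x / (4 * r) := by rw [le_div_iff₀ (by positivity)]; linarith [hx.1]
    have h6 : x / (4 * r) ≤ 1/4 := by rw [div_le_iff₀ (by positivity)]; linarith [hx.2]
    have h2 : ‖((x / (4 * r) : ℝ) : UnitAddCircle) + ((1 / 4 : ℝ) : UnitAddCircle)‖ = x / (4 * r) + 1 / 4 := by
      rw [← AddCircle.coe_add, (AddCircle.norm_coe_eq_abs_iff (1:ℝ) one_ne_zero).2, abs_of_nonneg (by linarith)]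
      rw [abs_of_nonneg (by linarith)]; simp; linarith
    simp only [hG]
    rw [h2]
    congr 1
    field_simp
    ring
  have hηB : 0 ≤ η * B := by positivity
  have hA' : 0 ≤ Ac ε * (η * B) := by positivity
  obtain ⟨g₁, m₁, b₁, t₁, d₁⟩ := hasDec_side r k (fun v => cf G v) (2 * Real.pi / (4 * r)) (Ac ε * (η * B)) (ε / 4) hA'
    (by positivity) (fun M N hM hN x => by
      have := tail_pos hGc (η * B) ε h0 h1 hηB hGH ((x / (4 * r) : ℝ) : UnitAddCircle) _ M N hM hN le_rfl
      simpa only [fourier_ee, Int.cast_natCast] using this)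
  obtain ⟨g₂, m₂, b₂, t₂, d₂⟩ := hasDec_side r k (fun v => cf G (-v)) (-(2 * Real.pi / (4 * r))) (Ac ε * (η * B)) (ε / 4) hA'
    (by positivity) (fun M N hM hN x => by
      have := tail_neg hGc (η * B) ε h0 h1 hηB hGH ((x / (4 * r) : ℝ) : UnitAddCircle) M N hM hN
      simpa only [fourier_ee, Int.cast_natCast, Int.cast_neg, mul_neg, neg_mul] using this)
  have heq : ∀ x ∈ Set.Icc (-r) r, h x = cf G 0 + g₁ x + g₂ x := by
    intro x hx
    rw [← hGv x hx]
    refine tendsto_nhds_unique (Sop_tendsto hGc (η * B) ε h0 h1 hηB hGH _) ?_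
    simp_rw [Sop_split]
    refine (tendsto_const_nhds.add ?_).add ?_
    · refine ((tendsto_add_atTop_iff_nat 1).2 (t₁ x)).congr fun M => ?_
      simp only [fourier_ee, Int.cast_natCast]
    · refine ((tendsto_add_atTop_iff_nat 1).2 (t₂ x)).congr fun M => ?_
      simp only [fourier_ee, Int.cast_natCast, Int.cast_neg, mul_neg, neg_mul]
  have hcf : ‖cf G 0‖ ≤ η := by
    unfold cf
    have := norm_integral_le_of_norm_le_const (μ := (volume : Measure UnitAddCircle)) (f := fun t => G t * fourier (-0) t) (C := η)
      (Eventually.of_forall fun t => by rw [norm_mul, fourier_norm_one, mul_one]; exact hGb t)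
    simpa [measureReal_def] using this
  have hd := ((hasDec_const r k (∫ s in Splx k, cf G 0)).add d₁).add d₂
  refine (hd.congr fun l hl => ?_).mono ?_
  · have i₁ : Integrable (fun s => g₁ (affc s l)) (volume.restrict (Splx k)) :=
      Integrable.of_bound (C := Ac ε * (η * B)) (m₁.comp (continuous_affc l).measurable).aestronglyMeasurable (Eventually.of_forall fun s => b₁ _)
    have i₂ : Integrable (fun s => g₂ (affc s l)) (volume.restrict (Splx k)) :=
      Integrable.of_bound (C := Ac ε * (η * B)) (m₂.comp (continuous_affc l).measurable).aestronglyMeasurable (Eventually.of_forall fun s => b₂ _)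
    have i₃ : Integrable (fun s => cf G 0 + g₁ (affc s l)) (volume.restrict (Splx k)) :=
      (integrable_const _).add i₁
    rw [← integral_add (integrable_const _) i₁, ← integral_add i₃ i₂]
    refine setIntegral_congr_fun (splx_meas k 1) fun s hs => ?_
    exact (heq _ (affc_mem hs hl)).symm
  · have e1 : ((‖∫ s in Splx k, cf G 0‖₊ : ℝ≥0) : ℝ≥0∞) ≤ ENNReal.ofReal V * ENNReal.ofReal η := by
      rw [← ENNReal.ofReal_mul (by positivity)]
      rw [← enorm_eq_nnnorm, ← ofReal_norm]
      apply ENNReal.ofReal_le_ofReal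
      rw [integral_const, norm_smul, Real.norm_of_nonneg (by positivity), measureReal_restrict_apply_univ]
      gcongr
    have e2 : ENNReal.ofReal (Ac ε * (η * B)) * Cdec k (ε / 4) = D * ENNReal.ofReal η := by
      rw [hD, mul_right_comm, ← ENNReal.ofReal_mul (by positivity)]
      congr 2; ring
    rw [e2, add_mul, add_mul]
    gcongr

lemma lip_of_deriv {h h' : ℝ → ℂ} (hd : ∀ x, HasDerivAt h (h' x) x) {s : Set ℝ} (hs : Convex ℝ s) {C : ℝ}
    (hb : ∀ x ∈ s, ‖h' x‖ ≤ C) {x y : ℝ} (hx : x ∈ s) (hy : y ∈ s) : ‖h x - h y‖ ≤ C * |x - y| := by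
  have := hs.norm_image_sub_le_of_norm_hasDerivWithin_le (f := h) (f' := h') (C := C)
    (fun z _ => (hd z).hasDerivWithinAt) hb hy hx
  simpa [Real.norm_eq_abs] using this

lemma itd_hasDerivAt {k : ℕ} {h : ℝ → ℂ} (hh : ContDiff ℝ k h) {j : ℕ} (hj : j < k) (x : ℝ) :
    HasDerivAt (iteratedDeriv j h) (iteratedDeriv (j + 1) h x) x := by
  rw [iteratedDeriv_succ]
  exact ((hh.differentiable_iteratedDeriv j (by exact_mod_cast hj)) x).hasDerivAt

lemma cNorm_bound (k : ℕ) (r a : ℝ) (hr : 0 < r) (h0 : 0 < a) (h1 : a ≤ 1) :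
    ∃ K : ℝ≥0∞, K ≠ ∞ ∧ ∀ (h : ℝ → ℂ) (η : ℝ), ContDiff ℝ k h → 0 ≤ η →
      (∀ j ≤ k, ∀ x ∈ Set.Icc (-r) r, ‖iteratedDeriv j h x‖ ≤ η) →
      (∀ x ∈ Set.Icc (-r) r, ∀ y ∈ Set.Icc (-r) r,
        ‖iteratedDeriv k h x - iteratedDeriv k h y‖ ≤ η * |x - y| ^ a) →
      cNorm k r h ≤ K * ENNReal.ofReal η := by
  choose K1 hK1 hc1 using fun j => core j r 1 hr one_pos le_rfl
  obtain ⟨K2, hK2, hc2⟩ := core k r a hr h0 h1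
  refine ⟨∑ j ∈ Finset.range k, K1 j + K2, ?_, ?_⟩
  · exact ENNReal.add_ne_top.2 ⟨ENNReal.sum_ne_top.2 fun j _ => hK1 j, hK2⟩
  intro h η hh hη hb hH
  unfold cNorm
  rw [Finset.sum_range_succ, add_mul, Finset.sum_mul]
  refine add_le_add (Finset.sum_le_sum fun j hj => ?_) ?_
  · have hj : j < k := Finset.mem_range.1 hj
    refine (hc1 j (iteratedDeriv j h) η hη (hb j hj.le) fun x hx y hy => ?_).le
    rw [Real.rpow_one]
    exact lip_of_deriv (itd_hasDerivAt hh hj) (convex_Icc _ _) (hb (j + 1) hj) hx hy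
  · exact (hc2 (iteratedDeriv k h) η hη (hb k le_rfl) hH).le

lemma poly_antideriv (p : Polynomial ℂ) : ∃ q : Polynomial ℂ, Polynomial.derivative q = p := by
  induction p using Polynomial.induction_on' with
  | add p q hp hq =>
    obtain ⟨a, ha⟩ := hp
    obtain ⟨b, hb⟩ := hq
    exact ⟨a + b, by simp [ha, hb]⟩
  | monomial n a =>
    refine ⟨Polynomial.monomial (n + 1) (a / (n + 1)), ?_⟩
    rw [Polynomial.derivative_monomial]
    have : (n : ℂ) + 1 ≠ 0 := by exact_mod_cast Nat.succ_ne_zero n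
    simp; field_simp

lemma poly_antideriv' (p : Polynomial ℂ) (c : ℂ) :
    ∃ q : Polynomial ℂ, Polynomial.derivative q = p ∧ q.eval 0 = c := by
  obtain ⟨q, hq⟩ := poly_antideriv p
  exact ⟨q - Polynomial.C (q.eval 0) + Polynomial.C c, by simp [hq], by simp⟩

lemma poly_hasDerivAt (q : Polynomial ℂ) (x : ℝ) :
    HasDerivAt (fun x : ℝ => q.eval (x : ℂ)) ((Polynomial.derivative q).eval (x : ℂ)) x :=
  (q.hasDerivAt (x : ℂ)).comp_ofReal

lemma poly_itd (q : Polynomial ℂ) (j : ℕ) :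
    iteratedDeriv j (fun x : ℝ => q.eval (x : ℂ)) = fun x : ℝ => (Polynomial.derivative^[j] q).eval (x : ℂ) := by
  induction j with
  | zero => simp
  | succ j ih =>
    rw [iteratedDeriv_succ, ih, Function.iterate_succ_apply']
    funext x
    exact (poly_hasDerivAt _ x).deriv

lemma poly_contDiff (q : Polynomial ℂ) (n : ℕ) : ContDiff ℝ n (fun x : ℝ => q.eval (x : ℂ)) := by
  have h1 : ContDiff ℂ n (fun z : ℂ => q.eval z) := by
    simpa using q.contDiff_aeval (𝕜 := ℂ) n
  exact (h1.restrict_scalars ℝ).comp Complex.ofRealCLM.contDiff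

lemma poly_near (R η : ℝ) (hη : 0 < η) (g : ℝ → ℂ) (hg : Continuous g) :
    ∃ p : Polynomial ℂ, ∀ x ∈ Set.Icc (-R) R, ‖g x - p.eval (x : ℂ)‖ ≤ η := by
  obtain ⟨p₁, h₁⟩ := exists_polynomial_near_of_continuousOn (-R) R (fun x => (g x).re) (by fun_prop) (η / 2) (by positivity)
  obtain ⟨p₂, h₂⟩ := exists_polynomial_near_of_continuousOn (-R) R (fun x => (g x).im) (by fun_prop) (η / 2) (by positivity)
  refine ⟨p₁.map (algebraMap ℝ ℂ) + Polynomial.C Complex.I * p₂.map (algebraMap ℝ ℂ), fun x hx => ?_⟩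
  have e : ∀ p : Polynomial ℝ, (p.map (algebraMap ℝ ℂ)).eval (x : ℂ) = (p.eval x : ℝ) := by
    intro p
    rw [Polynomial.eval_map, ← Complex.coe_algebraMap, Polynomial.eval₂_at_apply]
  rw [Polynomial.eval_add, Polynomial.eval_mul, e, e, Polynomial.eval_C]
  have a1 := h₁ x hx
  have a2 := h₂ x hx
  refine (Complex.norm_le_abs_re_add_abs_im _).trans ?_
  rw [abs_sub_comm] at a1 a2
  simp
  linarith

lemma poly_lift (R : ℝ) (hR : 1 ≤ R) (η : ℝ) (P : Polynomial ℂ) : ∀ (k : ℕ) (f : ℝ → ℂ), ContDiff ℝ k f →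
    (∀ x ∈ Set.Icc (-R) R, ‖iteratedDeriv k f x - P.eval (x : ℂ)‖ ≤ η) →
    ∃ q : Polynomial ℂ, Polynomial.derivative^[k] q = P ∧ ∀ j ≤ k, ∀ x ∈ Set.Icc (-R) R,
      ‖iteratedDeriv j f x - (Polynomial.derivative^[j] q).eval (x : ℂ)‖ ≤ R ^ k * η := by
  intro k
  induction k with
  | zero =>
    intro f _ h
    refine ⟨P, rfl, fun j hj x hx => ?_⟩
    obtain rfl : j = 0 := by omega
    simpa using h x hx
  | succ k ih =>
    intro f hf h
    have hz : (0 : ℝ) ∈ Set.Icc (-R) R := ⟨by linarith, by linarith⟩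
    have hη : 0 ≤ η := (norm_nonneg _).trans (h 0 hz)
    have hf' : ContDiff ℝ ((k : WithTop ℕ∞) + 1) f := by exact_mod_cast hf
    obtain ⟨hf1, -, hf2⟩ := contDiff_succ_iff_deriv.1 hf'
    rw [iteratedDeriv_succ'] at h
    obtain ⟨q', hq', hb⟩ := ih (deriv f) hf2 h
    obtain ⟨q, hq, hq0⟩ := poly_antideriv' q' (f 0)
    refine ⟨q, by rw [Function.iterate_succ_apply, hq, hq'], ?_⟩
    intro j hj x hx
    rcases j with _ | j
    · have := lip_of_deriv (h := fun x => f x - q.eval (x : ℂ)) (h' := fun x => deriv f x - q'.eval (x : ℂ))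
        (fun x => (hf1 x).hasDerivAt.sub (by rw [← hq]; exact poly_hasDerivAt q x)) (convex_Icc (-R) R) (C := R ^ k * η)
        (fun y hy => by simpa using hb 0 (Nat.zero_le _) y hy) hx hz
      simp only [Complex.ofReal_zero, hq0, sub_self, sub_zero] at this
      simp only [iteratedDeriv_zero, Function.iterate_zero, id]
      refine this.trans ?_
      rw [pow_succ, mul_right_comm]
      gcongr
      exact abs_le.2 hx
    · rw [iteratedDeriv_succ', Function.iterate_succ_apply, hq]
      refine (hb j (by omega) x hx).trans ?_
      gcongr
      omega

lemma holder_approx (g : ℝ → ℂ) (hg : Continuous g) (R e C η : ℝ) (hR : 1 ≤ R) (h0 : 0 < e) (h1 : e ≤ 1) (hC : 0 ≤ C)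
    (hη : 0 < η)
    (hH : ∀ x ∈ Set.Icc (-(R + 1)) (R + 1), ∀ y ∈ Set.Icc (-(R + 1)) (R + 1), ‖g x - g y‖ ≤ C * |x - y| ^ e) :
    ∃ P : Polynomial ℂ, (∀ x ∈ Set.Icc (-R) R, ‖g x - P.eval (x : ℂ)‖ ≤ η) ∧
      ∀ x ∈ Set.Icc (-R) R, ∀ y ∈ Set.Icc (-R) R,
        ‖(g x - P.eval (x : ℂ)) - (g y - P.eval (y : ℂ))‖ ≤ η * |x - y| ^ (e / 2) := by
  set m : ℝ := min 1 (η / (4 * (C + 1))) with hm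
  have hm0 : 0 < m := by positivity
  set δ : ℝ := m ^ (2 / e) with hδ
  have hδ0 : 0 < δ := by positivity
  have hδm : δ ^ (e / 2) = m := by
    rw [hδ, ← Real.rpow_mul hm0.le]
    have : 2 / e * (e / 2) = 1 := by field_simp
    rw [this, Real.rpow_one]
  have hm1 : m ≤ 1 := min_le_left _ _
  have hδ1 : δ ≤ 1 := Real.rpow_le_one hm0.le hm1 (by positivity)
  have hmC : 2 * C * m ≤ η / 2 := by
    have : m ≤ η / (4 * (C + 1)) := min_le_right _ _
    rw [le_div_iff₀ (by positivity)] at this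
    nlinarith
  have hsplit : ∀ d : ℝ, 0 ≤ d → d ^ e = d ^ (e / 2) * d ^ (e / 2) := by
    intro d hd
    rw [← Real.rpow_add_of_nonneg hd (by positivity) (by positivity)]
    congr 1; ring
  set H : ℝ → ℂ := fun x => ∫ u in (0:ℝ)..x, g u with hHdef
  have hHd : ∀ x, HasDerivAt H (g x) x := fun x => hg.integral_hasStrictDerivAt 0 x |>.hasDerivAt
  set G : ℝ → ℂ := fun x => ((δ⁻¹ : ℝ) : ℂ) * (H (x + δ) - H x) with hG
  set G' : ℝ → ℂ := fun x => ((δ⁻¹ : ℝ) : ℂ) * (g (x + δ) - g x) with hG'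
  have hGd : ∀ x, HasDerivAt G (G' x) x := fun x =>
    (((hHd (x + δ)).comp_add_const x δ).sub (hHd x)).const_mul _
  have hnorm : ‖((δ⁻¹ : ℝ) : ℂ)‖ = δ⁻¹ := by
    rw [Complex.norm_real, Real.norm_of_nonneg (by positivity)]
  have hsup : ∀ x ∈ Set.Icc (-R) R, ‖g x - G x‖ ≤ C * δ ^ e := by
    intro x hx
    have := lip_of_deriv (h := fun u => H u - u * g x) (h' := fun u => g u - 1 * g x)
      (fun u => (hHd u).sub ((HasDerivAt.ofReal_comp (hasDerivAt_id u)).mul_const (g x))) (convex_Icc x (x + δ)) (C := C * δ ^ e) ?_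
      (x := x + δ) (y := x) (by constructor <;> linarith) (by constructor <;> linarith)
    · have e1 : g x - G x = - (((δ⁻¹ : ℝ) : ℂ) * (H (x + δ) - (x + δ : ℝ) * g x - (H x - x * g x))) := by
        have : (δ : ℂ) ≠ 0 := by exact_mod_cast hδ0.ne'
        simp only [hG]; push_cast; field_simp; ring
      rw [e1, norm_neg, norm_mul, hnorm]
      calc _ ≤ δ⁻¹ * (C * δ ^ e * |x + δ - x|) := by gcongr
        _ = C * δ ^ e := by rw [add_sub_cancel_left, abs_of_pos hδ0]; field_simp
    · intro u hu
      rw [one_mul]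
      refine (hH u ⟨by linarith [hu.1, hx.1], by linarith [hu.2, hx.2]⟩ x ⟨by linarith [hx.1], by linarith [hx.2]⟩).trans ?_
      gcongr
      rw [abs_of_nonneg (by linarith [hu.1])]; linarith [hu.2]
  have hlip : ∀ x ∈ Set.Icc (-R) R, ∀ y ∈ Set.Icc (-R) R, ‖G x - G y‖ ≤ C * |x - y| ^ e := by
    intro x hx y hy
    have := lip_of_deriv (h := fun u => H (x + u) - H (y + u)) (h' := fun u => g (x + u) - g (y + u))
      (fun u => ((hHd (x + u)).comp_const_add x u).sub ((hHd (y + u)).comp_const_add y u)) (convex_Icc 0 δ) (C := C * |x - y| ^ e) ?_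
      (x := δ) (y := 0) (by constructor <;> linarith) (by constructor <;> linarith)
    · have e1 : G x - G y = (((δ⁻¹ : ℝ) : ℂ) * (H (x + δ) - H (y + δ) - (H (x + 0) - H (y + 0)))) := by
        simp only [hG, add_zero]; ring
      rw [e1, norm_mul, hnorm]
      calc _ ≤ δ⁻¹ * (C * |x - y| ^ e * |δ - 0|) := by gcongr
        _ = C * |x - y| ^ e := by rw [sub_zero, abs_of_pos hδ0]; field_simp
    · intro u hu
      refine (hH (x + u) ⟨by linarith [hu.1, hx.1], by linarith [hu.2, hx.2]⟩ (y + u) ⟨by linarith [hu.1, hy.1], by linarith [hu.2, hy.2]⟩).trans ?_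
      rw [add_sub_add_right_eq_sub]
  have hD : ∀ x ∈ Set.Icc (-R) R, ∀ y ∈ Set.Icc (-R) R, ‖(g x - G x) - (g y - G y)‖ ≤ 2 * C * m * |x - y| ^ (e / 2) := by
    intro x hx y hy
    rw [← hδm]
    rcases le_total |x - y| δ with hd | hd
    · calc ‖(g x - G x) - (g y - G y)‖ = ‖(g x - g y) - (G x - G y)‖ := by congr 1; ring
        _ ≤ C * |x - y| ^ e + C * |x - y| ^ e := (norm_sub_le _ _).trans (add_le_add
            (hH x ⟨by linarith [hx.1], by linarith [hx.2]⟩ y ⟨by linarith [hy.1], by linarith [hy.2]⟩) (hlip x hx y hy))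
        _ = 2 * C * |x - y| ^ (e / 2) * |x - y| ^ (e / 2) := by rw [hsplit _ (abs_nonneg _)]; ring
        _ ≤ _ := by gcongr
    · calc ‖(g x - G x) - (g y - G y)‖ ≤ C * δ ^ e + C * δ ^ e := (norm_sub_le _ _).trans (add_le_add (hsup x hx) (hsup y hy))
        _ = 2 * C * δ ^ (e / 2) * δ ^ (e / 2) := by rw [hsplit _ hδ0.le]; ring
        _ ≤ _ := by gcongr
  have hsup' : ∀ x ∈ Set.Icc (-R) R, ‖g x - G x‖ ≤ η / 2 := by
    intro x hx
    refine (hsup x hx).trans ?_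
    rw [hsplit _ hδ0.le, hδm]
    have : C * (m * m) ≤ C * m := by gcongr; nlinarith
    nlinarith [mul_nonneg hC hm0.le]
  obtain ⟨p, hp⟩ := poly_near R (η / (4 * R)) (by positivity) G' (by fun_prop)
  obtain ⟨P, hP, hP0⟩ := poly_antideriv' p (G 0)
  have hE : ∀ x ∈ Set.Icc (-R) R, ∀ y ∈ Set.Icc (-R) R,
      ‖(G x - P.eval (x : ℂ)) - (G y - P.eval (y : ℂ))‖ ≤ η / (4 * R) * |x - y| := by
    intro x hx y hy
    exact lip_of_deriv (h := fun x => G x - P.eval (x : ℂ)) (h' := fun x => G' x - p.eval (x : ℂ))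
      (fun x => (hGd x).sub (by rw [← hP]; exact poly_hasDerivAt P x)) (convex_Icc (-R) R) hp hx hy
  refine ⟨P, fun x hx => ?_, fun x hx y hy => ?_⟩
  · have h2 := hE x hx 0 ⟨by linarith, by linarith⟩
    rw [Complex.ofReal_zero, hP0, sub_self, sub_zero, sub_zero] at h2
    have h3 : |x| ≤ R := abs_le.2 hx
    have h4 : η / (4 * R) * |x| ≤ η / 4 := by
      calc _ ≤ η / (4 * R) * R := by gcongr
        _ = η / 4 := by field_simp
    calc ‖g x - P.eval (x : ℂ)‖ = ‖(g x - G x) + (G x - P.eval (x : ℂ))‖ := by congr 1; ring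
      _ ≤ η / 2 + η / 4 := (norm_add_le _ _).trans (add_le_add (hsup' x hx) (h2.trans h4))
      _ ≤ η := by linarith
  · have h3 : |x - y| ≤ 2 * R := abs_le.2 ⟨by linarith [hx.1, hy.2], by linarith [hx.2, hy.1]⟩
    have h4 : |x - y| ≤ 2 * R * |x - y| ^ (e / 2) := by
      rcases (abs_nonneg (x - y)).eq_or_lt with h | h
      · rw [← h]; positivity
      calc |x - y| = |x - y| ^ (1 - e / 2) * |x - y| ^ (e / 2) := by
            rw [← Real.rpow_add h, sub_add_cancel, Real.rpow_one]
        _ ≤ (2 * R) ^ (1 - e / 2) * |x - y| ^ (e / 2) := by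
            gcongr
            linarith
        _ ≤ (2 * R) ^ (1 : ℝ) * |x - y| ^ (e / 2) := by
            gcongr
            · linarith
            · linarith
        _ = _ := by rw [Real.rpow_one]
    calc ‖(g x - P.eval (x : ℂ)) - (g y - P.eval (y : ℂ))‖
        = ‖((g x - G x) - (g y - G y)) + ((G x - P.eval (x : ℂ)) - (G y - P.eval (y : ℂ)))‖ := by congr 1; ring
      _ ≤ 2 * C * m * |x - y| ^ (e / 2) + η / (4 * R) * |x - y| := (norm_add_le _ _).trans (add_le_add (hD x hx y hy) (hE x hx y hy))
      _ ≤ η / 2 * |x - y| ^ (e / 2) + η / (4 * R) * (2 * R * |x - y| ^ (e / 2)) := by gcongr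
      _ = η * |x - y| ^ (e / 2) := by field_simp; ring

lemma holder_reduce {g : ℝ → ℂ} {ε : ℝ} {R C : ℝ} (hε : 0 < ε) (hR : 0 < R) (a : ℝ) (ha : 0 < a) (haε : a ≤ ε)
    (hH : ∀ x ∈ Set.Icc (-R) R, ∀ y ∈ Set.Icc (-R) R, ‖g x - g y‖ ≤ C * |x - y| ^ ε) :
    ∀ x ∈ Set.Icc (-R) R, ∀ y ∈ Set.Icc (-R) R, ‖g x - g y‖ ≤ (|C| * (2 * R) ^ (ε - a)) * |x - y| ^ a := by
  intro x hx y hy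
  have h3 : |x - y| ≤ 2 * R := abs_le.2 ⟨by linarith [hx.1, hy.2], by linarith [hx.2, hy.1]⟩
  have e1 : |x - y| ^ ε = |x - y| ^ (ε - a) * |x - y| ^ a := by
    rw [← Real.rpow_add_of_nonneg (abs_nonneg _) (by linarith) ha.le, sub_add_cancel]
  refine (hH x hx y hy).trans ?_
  calc C * |x - y| ^ ε ≤ |C| * |x - y| ^ ε := by gcongr; exact le_abs_self C
    _ = |C| * |x - y| ^ (ε - a) * |x - y| ^ a := by rw [e1]; ring
    _ ≤ _ := by gcongr

lemma approx_full (k : ℕ) (ε : ℝ) (hε : 0 < ε) (f : ℝ → ℂ) (hf : ContDiff ℝ k f)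
    (hHolder : ∀ r : ℝ, 0 < r → ∃ C : ℝ, ∀ x ∈ Set.Icc (-r) r, ∀ y ∈ Set.Icc (-r) r,
        ‖iteratedDeriv k f x - iteratedDeriv k f y‖ ≤ C * |x - y| ^ ε) (R η : ℝ) (hR : 1 ≤ R) (hη : 0 < η) :
    ∃ q : Polynomial ℂ,
      (∀ j ≤ k, ∀ x ∈ Set.Icc (-R) R, ‖iteratedDeriv j (fun x : ℝ => f x - q.eval (x : ℂ)) x‖ ≤ η) ∧
      (∀ x ∈ Set.Icc (-R) R, ∀ y ∈ Set.Icc (-R) R,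
        ‖iteratedDeriv k (fun x : ℝ => f x - q.eval (x : ℂ)) x -
          iteratedDeriv k (fun x : ℝ => f x - q.eval (x : ℂ)) y‖ ≤ η * |x - y| ^ (min ε 1 / 2)) := by
  obtain ⟨C, hC⟩ := hHolder (R + 1) (by linarith)
  have he0 : 0 < min ε 1 := by positivity
  have hC' := holder_reduce hε (by linarith) (min ε 1) he0 (min_le_left _ _) hC
  have hRk : 1 ≤ R ^ k := one_le_pow₀ hR
  obtain ⟨P, hP1, hP2⟩ := holder_approx (iteratedDeriv k f) (hf.continuous_iteratedDeriv k le_rfl) R (min ε 1) _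
    (η / R ^ k) hR he0 (min_le_right _ _) (by positivity) (by positivity) hC'
  obtain ⟨q, hq, hb⟩ := poly_lift R hR _ P k f hf hP1
  have e : ∀ j ≤ k, ∀ x : ℝ, iteratedDeriv j (fun x : ℝ => f x - q.eval (x : ℂ)) x =
      iteratedDeriv j f x - (Polynomial.derivative^[j] q).eval (x : ℂ) := by
    intro j hj x
    have h1 : ContDiffAt ℝ j f x := (hf.of_le (by exact_mod_cast hj)).contDiffAt
    have := iteratedDeriv_fun_sub h1 (poly_contDiff q j).contDiffAt
    rw [this, poly_itd]
  refine ⟨q, fun j hj x hx => ?_, fun x hx y hy => ?_⟩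
  · rw [e j hj]
    refine (hb j hj x hx).trans (le_of_eq ?_)
    field_simp
  · rw [e k le_rfl, e k le_rfl, hq]
    refine (hP2 x hx y hy).trans ?_
    gcongr
    exact div_le_self hη.le hRk

/-- Theorem 3.10: `C_loc^{k,ε}(ℝ) ⊆ NC^k(ℝ)`: if `f ∈ C^k(ℝ)` and
`f^{(k)}` is `ε`-Hölder continuous on each interval `[-r,r]`, then `f ∈ 𝒞^{[k]}(ℝ)`
(i.e. `‖f‖_{𝒞^{[k]},r} < ∞` for all `r > 0`) and there is a sequence of polynomials `(q_n)`
with `‖f - q_n‖_{𝒞^{[k]},r} → 0` for every `r > 0`. -/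
theorem stmt_2 (k : ℕ) (hk : 1 ≤ k) (ε : ℝ) (hε : 0 < ε) (f : ℝ → ℂ)
    (hf : ContDiff ℝ (k : ℕ∞) f)
    (hHolder : ∀ r : ℝ, 0 < r → ∃ C : ℝ, ∀ x ∈ Set.Icc (-r) r, ∀ y ∈ Set.Icc (-r) r,
        ‖iteratedDeriv k f x - iteratedDeriv k f y‖ ≤ C * |x - y| ^ ε) :
    (∀ r : ℝ, 0 < r → cNorm k r f ≠ ∞) ∧
      ∃ q : ℕ → Polynomial ℂ, ∀ r : ℝ, 0 < r →
        Filter.Tendsto (fun n => cNorm k r (fun x => f x - (q n).eval (x : ℂ)))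
          Filter.atTop (nhds 0) := by
  have hf' : ContDiff ℝ k f := by exact_mod_cast hf
  set a : ℝ := min ε 1 / 2 with ha
  have he0 : 0 < min ε 1 := by positivity
  have ha0 : 0 < a := by positivity
  have ha1 : a ≤ 1 := by have := min_le_right ε 1; linarith
  have haε : a ≤ ε := by have := min_le_left ε 1; linarith
  constructor
  · intro r hr
    obtain ⟨K, hK, hb⟩ := cNorm_bound k r a hr ha0 ha1
    obtain ⟨C, hC⟩ := hHolder r hr
    have hC' := holder_reduce hε hr a ha0 haε hC
    set C' := |C| * (2 * r) ^ (ε - a) with hC'def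
    have hC0 : 0 ≤ C' := by positivity
    have hex : ∀ j : ℕ, ∃ B : ℝ, 0 ≤ B ∧ (j ≤ k → ∀ x ∈ Set.Icc (-r) r, ‖iteratedDeriv j f x‖ ≤ B) := by
      intro j
      by_cases hj : j ≤ k
      · have hc : Continuous (iteratedDeriv j f) := hf'.continuous_iteratedDeriv j (by exact_mod_cast hj)
        obtain ⟨B, hB⟩ := isCompact_Icc.exists_bound_of_continuousOn (s := Set.Icc (-r) r) hc.continuousOn
        exact ⟨max B 0, le_max_right _ _, fun _ x hx => (hB x hx).trans (le_max_left _ _)⟩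
      · exact ⟨0, le_rfl, fun h => absurd h hj⟩
    choose B hB0 hB using hex
    have hS : 0 ≤ ∑ j ∈ Finset.range (k + 1), B j := Finset.sum_nonneg fun j _ => hB0 j
    refine ne_top_of_le_ne_top ?_ (hb f (C' + ∑ j ∈ Finset.range (k + 1), B j) hf' (by positivity) ?_ ?_)
    · exact ENNReal.mul_ne_top hK ENNReal.ofReal_ne_top
    · intro j hj x hx
      have := Finset.single_le_sum (f := B) (fun j _ => hB0 j) (Finset.mem_range.2 (Nat.lt_succ_of_le hj))
      linarith [hB j hj x hx]
    · intro x hx y hy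
      refine (hC' x hx y hy).trans ?_
      gcongr
      linarith
  · choose q hq1 hq2 using fun n : ℕ => approx_full k ε hε f hf' hHolder (n + 1) (1 / (n + 1))
      (by have : (0:ℝ) ≤ n := Nat.cast_nonneg n
          linarith) (by positivity)
    refine ⟨q, fun r hr => ?_⟩
    obtain ⟨K, hK, hb⟩ := cNorm_bound k r a hr ha0 ha1
    have hlim : Tendsto (fun n : ℕ => K * ENNReal.ofReal (1 / ((n : ℝ) + 1))) atTop (nhds 0) := by
      have h1 : Tendsto (fun n : ℕ => ENNReal.ofReal (1 / ((n : ℝ) + 1))) atTop (nhds 0) := by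
        simpa using ENNReal.tendsto_ofReal tendsto_one_div_add_atTop_nhds_zero_nat
      simpa using ENNReal.Tendsto.const_mul h1 (Or.inr hK)
    refine tendsto_of_tendsto_of_tendsto_of_le_of_le' tendsto_const_nhds hlim (Eventually.of_forall fun _ => zero_le) ?_
    filter_upwards [eventually_ge_atTop ⌈r⌉₊] with n hn
    have hn' : r ≤ n := (Nat.le_ceil r).trans (by exact_mod_cast hn)
    have hsub : Set.Icc (-r) r ⊆ Set.Icc (-((n : ℝ) + 1)) (n + 1) := Set.Icc_subset_Icc (by linarith) (by linarith)
    exact hb _ _ (hf'.sub (poly_contDiff (q n) k)) (by positivity) (fun j hj x hx => hq1 n j hj x (hsub hx))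
      (fun x hx y hy => hq2 n x (hsub hx) y (hsub hy))
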